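/- arXiv:1709.03333 — 3 statements merged into one kernel-verified Lean document; each statement's English description precedes it below -/
import Mathlib

section
/- Let (Ω, Σ, μ) be a probability measure space and let (f_n) be a sequence in L¹(μ) with sup_n ‖f_n‖₁ < ∞. Then there exist a strictly increasing map φ : ℕ → ℕ and a function g ∈ L¹(μ) such that for every strictly increasing map ψ : ℕ → ℕ, the Cesàro means (1/n)·Σ_{i=1}^n f_{φ(ψ(i))} converge to g μ-almost everywhere as n → ∞. -/
open MeasureTheory Filter Topology

namespace Komlos

lemma weak_ultra {H : Type*} [NormedAddCommGroup H] [InnerProductSpace ℝ H] [CompleteSpace H]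
    (U : Ultrafilter ℕ) (x : ℕ → H) (C : ℝ) (hx : ∀ n, ‖x n‖ ≤ C) :
    ∃ g : H, ∀ v, Tendsto (fun n => inner ℝ (x n) v) U (𝓝 (inner ℝ g v)) := by
  let y : ℕ → WeakDual ℝ H := fun n =>
    StrongDual.toWeakDual (InnerProductSpace.toDual ℝ H (x n))
  obtain ⟨w, -, hw⟩ := (WeakDual.isCompact_closedBall (𝕜 := ℝ) (E := H) 0 C).ultrafilter_le_nhds
    (U.map y) (by
      simp only [le_principal_iff]
      refine Filter.mem_map.2 (Filter.univ_mem' fun n => ?_)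
      simp only [Set.mem_preimage, Metric.mem_closedBall, dist_zero_right, y]
      simpa using hx n)
  refine ⟨(InnerProductSpace.toDual ℝ H).symm (WeakDual.toStrongDual w), fun v => ?_⟩
  have h1 : Tendsto y U (𝓝 w) := hw
  have h2 := ((WeakDual.eval_continuous (𝕜 := ℝ) (E := H) v).tendsto w).comp h1
  rw [InnerProductSpace.toDual_symm_apply]
  exact h2

lemma real_ultra (U : Ultrafilter ℕ) (x : ℕ → ℝ) (a b : ℝ) (hx : ∀ n, x n ∈ Set.Icc a b) :
    ∃ t : ℝ, Tendsto x U (𝓝 t) := by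
  obtain ⟨w, -, hw⟩ := (isCompact_Icc (a := a) (b := b)).ultrafilter_le_nhds
    (U.map x) (by
      simp only [le_principal_iff]
      exact Filter.mem_map.2 (Filter.univ_mem' fun n => hx n))
  exact ⟨w, hw⟩

lemma selection (U : Ultrafilter ℕ) (hU : (U : Filter ℕ) ≤ atTop)
    (Q : ℕ → ℕ → Prop) (R : ℕ → ℕ → ℕ → ℕ → Prop)
    (hQ : ∀ n, ∀ᶠ b in (U : Filter ℕ), Q n b)
    (hR : ∀ n n' a, ∀ᶠ b in (U : Filter ℕ), R n n' a b) :
    ∃ φ : ℕ → ℕ, ∃ N : ℕ → ℕ, StrictMono φ ∧ StrictMono N ∧ (∀ n, Q (N n) (φ n)) ∧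
      ∀ m n, m < n → R (N m) (N n) (φ m) (φ n) := by
  obtain ⟨f, hf1, hf2⟩ := exists_seq_of_forall_finset_exists (α := ℕ × ℕ)
    (fun p => Q p.1 p.2) (fun p q => p.1 < q.1 ∧ p.2 < q.2 ∧ R p.1 q.1 p.2 q.2) (by
      intro s _
      let n' := s.sup (fun p => p.1) + 1
      have h1 : ∀ᶠ b in (U : Filter ℕ), ∀ p ∈ s, p.2 < b ∧ R p.1 n' p.2 b := by
        rw [Filter.eventually_all_finset]
        intro p _
        exact Filter.Eventually.and (hU (eventually_gt_atTop p.2)) (hR _ _ _)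
      obtain ⟨b, hb1, hb2⟩ := (h1.and (hQ n')).exists
      refine ⟨(n', b), hb2, fun p hp => ⟨?_, hb1 p hp⟩⟩
      exact Nat.lt_succ_of_le (Finset.le_sup (f := fun p : ℕ × ℕ => p.1) hp))
  refine ⟨fun n => (f n).2, fun n => (f n).1, fun m n h => (hf2 m n h).2.1,
    fun m n h => (hf2 m n h).1, hf1, fun m n h => (hf2 m n h).2.2⟩

lemma norm_sum_sq_le {H : Type*} [NormedAddCommGroup H] [InnerProductSpace ℝ H]
    (Z : ℕ → H) (v : ℕ → ℝ) (hv : Monotone v) (hZ : ∀ i, ‖Z i‖ ^ 2 ≤ v i)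
    (hc : ∀ i j, i < j → |inner ℝ (Z i) (Z j)| ≤ 1 / ((j : ℝ) + 1)) (n : ℕ) :
    ‖∑ i ∈ Finset.range n, Z i‖ ^ 2 ≤ n * (v n + 2) := by
  have key : ∀ n : ℕ, ‖∑ i ∈ Finset.range n, Z i‖ ^ 2 ≤ ∑ i ∈ Finset.range n, (v i + 2) := by
    intro n
    induction n with
    | zero => simp
    | succ n ih =>
      rw [Finset.sum_range_succ, Finset.sum_range_succ, norm_add_sq_real, sum_inner]
      have h1 : ∑ i ∈ Finset.range n, inner ℝ (Z i) (Z n) ≤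
          ∑ i ∈ Finset.range n, 1 / ((n : ℝ) + 1) :=
        Finset.sum_le_sum fun i hi => (le_abs_self _).trans (hc i n (Finset.mem_range.1 hi))
      have h2 : ∑ i ∈ Finset.range n, 1 / ((n : ℝ) + 1) ≤ 1 := by
        simp only [Finset.sum_const, Finset.card_range, nsmul_eq_mul]
        rw [mul_one_div, div_le_one (by positivity)]
        linarith
      have := hZ n
      linarith
  refine (key n).trans ?_
  calc ∑ i ∈ Finset.range n, (v i + 2) ≤ ∑ i ∈ Finset.range n, (v n + 2) :=
        Finset.sum_le_sum fun i hi => by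
          have := hv (Finset.mem_range.1 hi).le
          linarith
    _ = _ := by simp [mul_add]

lemma geom_bound (c : ℝ) (hc : 1 < c) : ∃ C : ℝ, 0 ≤ C ∧ ∀ N l : ℕ,
    ∑ j ∈ Finset.range N with l < ⌊c ^ j⌋₊, 1 / (⌊c ^ j⌋₊ : ℝ) ≤ C / ((l : ℝ) + 1) := by
  have hc0 : 0 < c := by linarith
  set d := √c with hd
  have hdd : d ^ 2 = c := Real.sq_sqrt hc0.le
  have hd1 : 1 < d := by rw [hd]; exact Real.lt_sqrt_of_sq_lt (by simpa using hc)
  have hK : 0 < 1 - c⁻¹ := by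
    have := inv_lt_one_of_one_lt₀ hc
    linarith
  have hdi : 0 < (d - 1)⁻¹ := inv_pos.2 (by linarith)
  refine ⟨(1 - c⁻¹)⁻¹ * (d ^ 3 * (d - 1)⁻¹ * 2), by positivity, fun N l => ?_⟩
  have hl : (0 : ℝ) < ((l : ℝ) + 1) / 2 := by positivity
  have h1 := sum_div_pow_sq_le_div_sq N (Real.sqrt_pos.2 hl) hd1
  rw [Real.sq_sqrt hl.le] at h1
  calc ∑ j ∈ Finset.range N with l < ⌊c ^ j⌋₊, 1 / (⌊c ^ j⌋₊ : ℝ)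
      ≤ ∑ j ∈ Finset.range N with l < ⌊c ^ j⌋₊, (1 - c⁻¹)⁻¹ * (1 / (d ^ j) ^ 2) := by
        refine Finset.sum_le_sum fun j _ => ?_
        have h2 := mul_pow_le_nat_floor_pow hc j
        have h3 : (d ^ j) ^ 2 = c ^ j := by rw [← hdd]; ring
        rw [h3]
        calc 1 / (⌊c ^ j⌋₊ : ℝ) ≤ 1 / ((1 - c⁻¹) * c ^ j) :=
              one_div_le_one_div_of_le (by positivity) h2
          _ = _ := by rw [one_div, mul_inv, one_div]
    _ ≤ ∑ j ∈ Finset.range N with √(((l : ℝ) + 1) / 2) < d ^ j,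
          (1 - c⁻¹)⁻¹ * (1 / (d ^ j) ^ 2) := by
        refine Finset.sum_le_sum_of_subset_of_nonneg ?_ fun _ _ _ => by positivity
        intro j hj
        simp only [Finset.mem_filter] at hj ⊢
        refine ⟨hj.1, ?_⟩
        rw [Real.sqrt_lt' (by positivity)]
        have h3 : (d ^ j) ^ 2 = c ^ j := by rw [← hdd]; ring
        rw [h3]
        have h4 : ((l : ℝ) + 1) ≤ ⌊c ^ j⌋₊ := by exact_mod_cast hj.2
        have h5 := Nat.floor_le (pow_nonneg hc0.le j)
        have : (0 : ℝ) ≤ l := by positivity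
        linarith
    _ = (1 - c⁻¹)⁻¹ * ∑ j ∈ Finset.range N with √(((l : ℝ) + 1) / 2) < d ^ j,
          (1 / (d ^ j) ^ 2) := by rw [Finset.mul_sum]
    _ ≤ (1 - c⁻¹)⁻¹ * (d ^ 3 * (d - 1)⁻¹ / (((l : ℝ) + 1) / 2)) := by gcongr
    _ = _ := by field_simp

/-- The variance bound. -/
noncomputable def vb (p : ℕ → ℝ) (n : ℕ) : ℝ := ∑ l ∈ Finset.range n, (2 * (l : ℝ) + 1) * p l

lemma vb_mono (p : ℕ → ℝ) (hp : ∀ l, 0 ≤ p l) : Monotone (vb p) := by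
  intro m n h
  refine Finset.sum_le_sum_of_subset_of_nonneg (Finset.range_mono h) fun l _ _ => ?_
  have := hp l
  positivity

lemma vb_summable (p : ℕ → ℝ) (hp : ∀ l, 0 ≤ p l) (hs : Summable p) (c : ℝ) (hc : 1 < c) :
    Summable fun j : ℕ => vb p ⌊c ^ j⌋₊ / (⌊c ^ j⌋₊ : ℝ) := by
  obtain ⟨C, hC, hb⟩ := geom_bound c hc
  have hv : ∀ n, 0 ≤ vb p n := fun n => by
    simpa [vb] using vb_mono p hp (Nat.zero_le n)
  refine summable_of_sum_range_le (c := 2 * C * ∑' l, p l)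
    (fun j => div_nonneg (hv _) (by positivity)) fun N => ?_
  have hL : ∃ L, ∀ j ∈ Finset.range N, ⌊c ^ j⌋₊ ≤ L :=
    ⟨(Finset.range N).sup fun j => ⌊c ^ j⌋₊, fun j hj =>
      Finset.le_sup (f := fun j : ℕ => ⌊c ^ j⌋₊) hj⟩
  obtain ⟨L, hL⟩ := hL
  calc ∑ j ∈ Finset.range N, vb p ⌊c ^ j⌋₊ / (⌊c ^ j⌋₊ : ℝ)
      = ∑ j ∈ Finset.range N, ∑ l ∈ Finset.range L,
          (if l < ⌊c ^ j⌋₊ then (2 * (l : ℝ) + 1) * p l * (1 / (⌊c ^ j⌋₊ : ℝ)) else 0) := by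
        refine Finset.sum_congr rfl fun j hj => ?_
        rw [← Finset.sum_filter, vb, Finset.sum_div]
        have : (Finset.range L).filter (fun l => l < ⌊c ^ j⌋₊) = Finset.range ⌊c ^ j⌋₊ := by
          ext l
          have := hL j hj
          simp only [Finset.mem_filter, Finset.mem_range]
          omega
        rw [this]
        exact Finset.sum_congr rfl fun l _ => by ring
    _ = ∑ l ∈ Finset.range L, (2 * (l : ℝ) + 1) * p l *
          ∑ j ∈ Finset.range N with l < ⌊c ^ j⌋₊, 1 / (⌊c ^ j⌋₊ : ℝ) := by
        rw [Finset.sum_comm]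
        refine Finset.sum_congr rfl fun l _ => ?_
        rw [← Finset.sum_filter, Finset.mul_sum]
    _ ≤ ∑ l ∈ Finset.range L, 2 * C * p l := by
        refine Finset.sum_le_sum fun l _ => ?_
        have h0 := hp l
        calc (2 * (l : ℝ) + 1) * p l *
              ∑ j ∈ Finset.range N with l < ⌊c ^ j⌋₊, 1 / (⌊c ^ j⌋₊ : ℝ)
            ≤ (2 * (l : ℝ) + 1) * p l * (C / ((l : ℝ) + 1)) := by
              gcongr
              exact hb N l
          _ = ((2 * (l : ℝ) + 1) / ((l : ℝ) + 1)) * (C * p l) := by ring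
          _ ≤ 2 * (C * p l) := by
              gcongr
              rw [div_le_iff₀ (by positivity)]
              linarith
          _ = _ := by ring
    _ = 2 * C * ∑ l ∈ Finset.range L, p l := by rw [Finset.mul_sum]
    _ ≤ _ := by
        gcongr
        exact hs.sum_le_tsum _ fun l _ => hp l

lemma inv_summable (c : ℝ) (hc : 1 < c) :
    Summable fun j : ℕ => 1 / (⌊c ^ j⌋₊ : ℝ) := by
  have := vb_summable (fun l => if l = 0 then 1 else 0) (fun l => by positivity)
    (summable_of_ne_finset_zero (s := {0}) (by intro b hb; simp at hb; simp [hb])) c hc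
  refine this.congr fun j => ?_
  have h1 : 1 ≤ ⌊c ^ j⌋₊ := Nat.le_floor (by simpa using one_le_pow₀ hc.le)
  congr 1
  unfold vb
  rw [Finset.sum_eq_single 0]
  · simp
  · intro b _ hb; simp [hb]
  · intro h; simp at h; simp at h1; linarith

lemma min_sq_le (x : ℝ) (hx : 0 ≤ x) (k : ℕ) :
    (min x k) ^ 2 ≤ ∑ l ∈ Finset.range k, (2 * (l : ℝ) + 1) * (if (l : ℝ) < x then 1 else 0) := by
  induction k with
  | zero => simp [hx]
  | succ k ih =>
    rw [Finset.sum_range_succ]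
    refine le_trans ?_ (add_le_add_left ih _)
    push_cast
    split_ifs with h
    · rw [min_eq_right h.le]
      have h1 : min x ((k : ℝ) + 1) ≤ k + 1 := min_le_right _ _
      have h2 : 0 ≤ min x ((k : ℝ) + 1) := le_min hx (by positivity)
      nlinarith
    · rw [min_eq_left (not_lt.1 h), min_eq_left (by linarith [not_lt.1 h])]
      simp

lemma sum_ind_le (x : ℝ) (hx : 0 ≤ x) (k : ℕ) :
    ∑ l ∈ Finset.range k, (if (l : ℝ) < x then (1 : ℝ) else 0) ≤ x + 1 := by
  have : ∑ l ∈ Finset.range k, (if (l : ℝ) < x then (1 : ℝ) else 0) ≤ x + 1 ∧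
      ∑ l ∈ Finset.range k, (if (l : ℝ) < x then (1 : ℝ) else 0) ≤ k := by
    induction k with
    | zero => simp; linarith
    | succ k ih =>
      rw [Finset.sum_range_succ]
      push_cast
      split_ifs with h
      · constructor <;> linarith [ih.1, ih.2]
      · constructor <;> linarith [ih.1, ih.2]
  exact this.1

section meas

set_option linter.unusedSectionVars false

variable {Ω : Type*} [MeasurableSpace Ω] {μ : Measure Ω} [IsProbabilityMeasure μ]

lemma integral_ind (X : Ω → ℝ) (hX : Measurable X) (l : ℝ) :
    Integrable (fun ω => if l < X ω then (1 : ℝ) else 0) μ ∧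
    ∫ ω, (if l < X ω then (1 : ℝ) else 0) ∂μ = μ.real {ω | l < X ω} := by
  have hs : MeasurableSet {ω | l < X ω} := measurableSet_lt measurable_const hX
  have h : (fun ω => if l < X ω then (1 : ℝ) else 0) =
      Set.indicator {ω | l < X ω} (fun _ => (1 : ℝ)) := by
    ext ω; simp [Set.indicator]
  rw [h]
  refine ⟨(integrable_const _).indicator hs, ?_⟩
  rw [integral_indicator hs]
  simp

lemma memLp_min (X : Ω → ℝ) (hX : Measurable X) (h0 : ∀ ω, 0 ≤ X ω) (k : ℕ) (q : ENNReal) :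
    MemLp (fun ω => min (X ω) k) q μ := by
  refine MemLp.of_bound (hX.min measurable_const).aestronglyMeasurable k (ae_of_all _ fun ω => ?_)
  rw [Real.norm_of_nonneg (le_min (h0 ω) (by positivity))]
  exact min_le_right _ _

lemma integral_min_sq (X : Ω → ℝ) (hX : Measurable X) (h0 : ∀ ω, 0 ≤ X ω) (k : ℕ) :
    ∫ ω, (min (X ω) k) ^ 2 ∂μ ≤ vb (fun l => μ.real {ω | (l : ℝ) < X ω}) k := by
  have hi : ∀ l ∈ Finset.range k, Integrable (fun ω =>
      (2 * (l : ℝ) + 1) * (if (l : ℝ) < X ω then (1 : ℝ) else 0)) μ := fun l _ =>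
    (integral_ind X hX l).1.const_mul _
  calc ∫ ω, (min (X ω) k) ^ 2 ∂μ
      ≤ ∫ ω, ∑ l ∈ Finset.range k, (2 * (l : ℝ) + 1) * (if (l : ℝ) < X ω then 1 else 0) ∂μ :=
        integral_mono (memLp_min X hX h0 k 2).integrable_sq (integrable_finsetSum _ hi)
          fun ω => min_sq_le _ (h0 ω) k
    _ = _ := by
        rw [integral_finsetSum _ hi, vb]
        refine Finset.sum_congr rfl fun l _ => ?_
        rw [integral_const_mul, (integral_ind X hX l).2]

lemma sum_tail (X : Ω → ℝ) (hX : Measurable X) (hi : Integrable X μ) (h0 : ∀ ω, 0 ≤ X ω) (k : ℕ) :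
    ∑ l ∈ Finset.range k, μ.real {ω | (l : ℝ) < X ω} ≤ ∫ ω, X ω ∂μ + 1 := by
  calc ∑ l ∈ Finset.range k, μ.real {ω | (l : ℝ) < X ω}
      = ∫ ω, ∑ l ∈ Finset.range k, (if (l : ℝ) < X ω then (1 : ℝ) else 0) ∂μ := by
        rw [integral_finsetSum _ fun (l : ℕ) _ => (integral_ind X hX (l : ℝ)).1]
        exact Finset.sum_congr rfl fun l _ => ((integral_ind X hX l).2).symm
    _ ≤ ∫ ω, (X ω + 1) ∂μ :=
        integral_mono (integrable_finsetSum _ fun l _ => (integral_ind X hX l).1)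
          (hi.add (integrable_const _)) fun ω => sum_ind_le _ (h0 ω) k
    _ = _ := by rw [integral_add hi (integrable_const _)]; simp

/-- The truncations as elements of `L²`. -/
noncomputable def tr (μ : Measure Ω) [IsProbabilityMeasure μ] (F : ℕ → Ω → ℝ)
    (hm : ∀ n, Measurable (F n)) (h0 : ∀ n ω, 0 ≤ F n ω) (n k : ℕ) : Lp ℝ 2 μ :=
  (memLp_min (F n) (hm n) (h0 n) k 2).toLp _

lemma tr_coe (F : ℕ → Ω → ℝ)
    (hm : ∀ n, Measurable (F n)) (h0 : ∀ n ω, 0 ≤ F n ω) (n k : ℕ) :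
    tr μ F hm h0 n k =ᵐ[μ] fun ω => min (F n ω) k := MemLp.coeFn_toLp _

lemma norm_sq_L2 (f : Lp ℝ 2 μ) : ‖f‖ ^ 2 = ∫ ω, (f ω) ^ 2 ∂μ := by
  rw [← real_inner_self_eq_norm_sq, L2.inner_def]
  refine integral_congr_ae (ae_of_all _ fun ω => ?_)
  simp [sq]

lemma tr_norm (F : ℕ → Ω → ℝ)
    (hm : ∀ n, Measurable (F n)) (h0 : ∀ n ω, 0 ≤ F n ω) (n k : ℕ) :
    ‖tr μ F hm h0 n k‖ ^ 2 ≤ vb (fun l => μ.real {ω | (l : ℝ) < F n ω}) k := by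
  rw [norm_sq_L2]
  refine le_trans (le_of_eq ?_) (integral_min_sq (F n) (hm n) (h0 n) k)
  refine integral_congr_ae ?_
  filter_upwards [tr_coe F hm h0 n k] with ω hω
  rw [hω]

lemma vb_le_vb (p q : ℕ → ℝ) (k : ℕ) (h : ∀ l < k, p l ≤ q l) : vb p k ≤ vb q k := by
  refine Finset.sum_le_sum fun l hl => ?_
  have := h l (Finset.mem_range.1 hl)
  gcongr

lemma Lp_integrable (f : Lp ℝ 2 μ) : Integrable f μ := (Lp.memLp f).integrable (by norm_num)

lemma construct (F : ℕ → Ω → ℝ) (hm : ∀ n, Measurable (F n)) (hi : ∀ n, Integrable (F n) μ)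
    (h0 : ∀ n ω, 0 ≤ F n ω) (M : ℝ) (hM : ∀ n, ∫ ω, F n ω ∂μ ≤ M) :
    ∃ φ : ℕ → ℕ, ∃ G : ℕ → Lp ℝ 2 μ, ∃ p : ℕ → ℝ, StrictMono φ ∧ (∀ l, 0 ≤ p l) ∧ Summable p ∧
      (∀ n k : ℕ, k ≤ n → μ.real {ω | (k : ℝ) < F (φ n) ω} ≤ p k) ∧
      (∀ m n k l, m < n → k ≤ m → l ≤ n →
        |inner ℝ (tr μ F hm h0 (φ m) k - G k) (tr μ F hm h0 (φ n) l - G l)| ≤ 1 / ((n : ℝ) + 1)) ∧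
      (∀ k, ‖G k‖ ^ 2 ≤ vb p k) ∧ (∀ k, 0 ≤ᵐ[μ] G k) ∧ (∀ k, G k ≤ᵐ[μ] G (k + 1)) ∧
      (∀ k, ∫ ω, G k ω ∂μ ≤ M) := by
  obtain ⟨U, hU⟩ : ∃ U : Ultrafilter ℕ, (U : Filter ℕ) ≤ atTop :=
    ⟨hyperfilter ℕ, by rw [← Nat.cofinite_eq_atTop]; exact hyperfilter_le_cofinite⟩
  have hτ : ∀ k : ℕ, ∃ t : ℝ, Tendsto (fun n => μ.real {ω | (k : ℝ) < F n ω}) U (𝓝 t) :=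
    fun k => real_ultra U _ 0 1 fun n => ⟨measureReal_nonneg, measureReal_le_one⟩
  choose τ hτ using hτ
  have hG : ∀ k : ℕ, ∃ g : Lp ℝ 2 μ, ∀ v,
      Tendsto (fun n => inner ℝ (tr μ F hm h0 n k) v) U (𝓝 (inner ℝ g v)) := by
    intro k
    refine weak_ultra U _ (√(vb (fun _ => 1) k)) fun n => ?_
    refine Real.le_sqrt_of_sq_le ((tr_norm F hm h0 n k).trans (vb_le_vb _ _ _ ?_))
    exact fun l _ => measureReal_le_one
  choose G hG using hG
  have hτ0 : ∀ l, 0 ≤ τ l := fun l => ge_of_tendsto' (hτ l) fun n => measureReal_nonneg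
  have hτs : Summable τ := by
    refine summable_of_sum_range_le (c := M + 1) hτ0 fun K => ?_
    refine le_of_tendsto' (tendsto_finsetSum (Finset.range K) fun l _ => hτ l) fun n => ?_
    have := sum_tail (F n) (hm n) (hi n) (h0 n) K
    linarith [hM n]
  let p : ℕ → ℝ := fun k => τ k + (1 / 2) ^ k
  have hp0 : ∀ l, 0 ≤ p l := fun l => add_nonneg (hτ0 l) (by positivity)
  have hset : ∀ (k : ℕ) (s : Set Ω) (hs : MeasurableSet s),
      Tendsto (fun n => ∫ ω in s, min (F n ω) k ∂μ) U (𝓝 (∫ ω in s, G k ω ∂μ)) := by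
    intro k s hs
    have h1 := hG k (indicatorConstLp 2 hs (measure_ne_top μ s) 1)
    rw [real_inner_comm, L2.inner_indicatorConstLp_one] at h1
    refine h1.congr fun n => ?_
    rw [real_inner_comm, L2.inner_indicatorConstLp_one]
    refine integral_congr_ae (ae_restrict_of_ae ?_)
    exact tr_coe F hm h0 n k
  have hcross : ∀ (v : Lp ℝ 2 μ) (l : ℕ),
      Tendsto (fun b => |inner ℝ v (tr μ F hm h0 b l - G l)|) U (𝓝 0) := by
    intro v l
    have h1 := ((hG l v).sub_const (inner ℝ (G l) v)).abs
    rw [sub_self, abs_zero] at h1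
    refine h1.congr fun b => ?_
    rw [← inner_sub_left, real_inner_comm]
  obtain ⟨φ, N, hφ, hN, hq, hr⟩ := selection U hU
    (fun n b => ∀ k ∈ Finset.range (n + 1), μ.real {ω | (k : ℝ) < F b ω} ≤ p k)
    (fun n n' a b => ∀ k ∈ Finset.range (n + 1), ∀ l ∈ Finset.range (n' + 1),
      |inner ℝ (tr μ F hm h0 a k - G k) (tr μ F hm h0 b l - G l)| ≤ 1 / ((n' : ℝ) + 1))
    (by
      intro n
      rw [Filter.eventually_all_finset]
      intro k _
      refine (hτ k).eventually_le_const ?_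
      have : (0 : ℝ) < (1 / 2) ^ k := by positivity
      simp only [p]; linarith)
    (by
      intro n n' a
      rw [Filter.eventually_all_finset]
      intro k _
      rw [Filter.eventually_all_finset]
      intro l _
      exact (hcross _ l).eventually_le_const (by positivity))
  refine ⟨φ, G, p, hφ, hp0, ?_, ?_, ?_, ?_, ?_, ?_, ?_⟩
  · exact hτs.add (summable_geometric_of_lt_one (by norm_num) (by norm_num))
  · intro n k hk
    exact hq n k (Finset.mem_range.2 (by have := hN.le_apply (x := n); omega))
  · intro m n k l hmn hk hl
    refine (hr m n hmn k (Finset.mem_range.2 (by have := hN.le_apply (x := m); omega)) l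
      (Finset.mem_range.2 (by have := hN.le_apply (x := n); omega))).trans ?_
    refine one_div_le_one_div_of_le (by positivity) ?_
    have : (n : ℝ) ≤ N n := by exact_mod_cast hN.le_apply
    linarith
  · intro k
    have h1 : ‖G k‖ ^ 2 ≤ √(vb τ k) * ‖G k‖ := by
      have h2 := hG k (G k)
      rw [real_inner_self_eq_norm_sq] at h2
      have h3 : Tendsto (fun n => √(vb (fun l => μ.real {ω | (l : ℝ) < F n ω}) k) * ‖G k‖) U
          (𝓝 (√(vb τ k) * ‖G k‖)) := by
        refine Tendsto.mul_const _ ?_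
        refine (Real.continuous_sqrt.tendsto _).comp ?_
        exact tendsto_finsetSum _ fun l _ => (hτ l).const_mul _
      refine le_of_tendsto_of_tendsto' h2 h3 fun n => ?_
      refine (real_inner_le_norm _ _).trans ?_
      gcongr
      exact Real.le_sqrt_of_sq_le (tr_norm F hm h0 n k)
    have hv : 0 ≤ vb τ k := by simpa [vb] using vb_mono τ hτ0 (Nat.zero_le k)
    have h4 : ‖G k‖ ≤ √(vb τ k) := by
      by_contra hcon
      push Not at hcon
      have : 0 < ‖G k‖ := lt_of_le_of_lt (Real.sqrt_nonneg _) hcon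
      nlinarith
    calc ‖G k‖ ^ 2 ≤ √(vb τ k) ^ 2 := by gcongr
      _ = vb τ k := Real.sq_sqrt hv
      _ ≤ _ := vb_le_vb _ _ _ fun l _ => by simp [p]
  · intro k
    refine ae_le_of_forall_setIntegral_le (integrable_zero _ _ _) (Lp_integrable _) fun s hs _ => ?_
    refine le_of_tendsto_of_tendsto' tendsto_const_nhds (hset k s hs) fun n => ?_
    simp only [Pi.zero_apply, integral_zero]
    exact integral_nonneg fun ω => le_min (h0 n ω) (by positivity)
  · intro k
    refine ae_le_of_forall_setIntegral_le (Lp_integrable _) (Lp_integrable _) fun s hs _ => ?_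
    refine le_of_tendsto_of_tendsto' (hset k s hs) (hset (k + 1) s hs) fun n => ?_
    refine integral_mono ((memLp_min (F n) (hm n) (h0 n) k 1).integrable le_rfl).integrableOn
      ((memLp_min (F n) (hm n) (h0 n) (k + 1) 1).integrable le_rfl).integrableOn fun ω => ?_
    refine min_le_min_left _ ?_
    push_cast; linarith
  · intro k
    have h1 := hset k Set.univ MeasurableSet.univ
    simp only [Measure.restrict_univ] at h1
    refine le_of_tendsto' h1 fun n => le_trans ?_ (hM n)
    exact integral_mono ((memLp_min (F n) (hm n) (h0 n) k 1).integrable le_rfl) (hi n)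
      fun ω => min_le_left _ _

lemma mono_limit (G : ℕ → Ω → ℝ) (hGi : ∀ k, Integrable (G k) μ) (h0 : ∀ k, 0 ≤ᵐ[μ] G k)
    (hmono : ∀ k, G k ≤ᵐ[μ] G (k + 1)) (M : ℝ) (hM : ∀ k, ∫ ω, G k ω ∂μ ≤ M) :
    ∃ g : Ω → ℝ, Integrable g μ ∧ ∀ᵐ ω ∂μ, Tendsto (fun k => G k ω) atTop (𝓝 (g ω)) := by
  have hmono' : ∀ᵐ ω ∂μ, Monotone fun k => G k ω := by
    filter_upwards [ae_all_iff.2 hmono] with ω hω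
    exact monotone_nat_of_le_succ hω
  have hme : ∀ k, AEMeasurable (fun ω => ENNReal.ofReal (G k ω)) μ := fun k =>
    (hGi k).aemeasurable.ennreal_ofReal
  have hsup : ∫⁻ ω, ⨆ k, ENNReal.ofReal (G k ω) ∂μ ≠ ⊤ := by
    rw [lintegral_iSup' hme (by
      filter_upwards [hmono'] with ω hω
      exact fun a b hab => ENNReal.ofReal_le_ofReal (hω hab))]
    refine ne_top_of_le_ne_top (ENNReal.ofReal_ne_top (r := M)) (iSup_le fun k => ?_)
    rw [← ofReal_integral_eq_lintegral_ofReal (hGi k) (h0 k)]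
    exact ENNReal.ofReal_le_ofReal (hM k)
  refine ⟨fun ω => (⨆ k, ENNReal.ofReal (G k ω)).toReal,
    integrable_toReal_of_lintegral_ne_top (AEMeasurable.iSup hme) hsup, ?_⟩
  filter_upwards [hmono', ae_lt_top' (AEMeasurable.iSup hme) hsup, ae_all_iff.2 h0] with ω h1 h2 h3
  have h4 : Tendsto (fun k => ENNReal.ofReal (G k ω)) atTop (𝓝 (⨆ k, ENNReal.ofReal (G k ω))) :=
    tendsto_atTop_iSup fun a b hab => ENNReal.ofReal_le_ofReal (h1 hab)
  refine ((ENNReal.tendsto_toReal h2.ne).comp h4).congr fun k => ?_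
  exact ENNReal.toReal_ofReal (h3 k)

lemma ae_tendsto_zero (A : ℕ → Lp ℝ 2 μ) (hA : Summable fun j => ‖A j‖ ^ 2) :
    ∀ᵐ ω ∂μ, Tendsto (fun j => A j ω) atTop (𝓝 0) := by
  have hme : ∀ j, AEMeasurable (fun ω => ENNReal.ofReal ((A j ω) ^ 2)) μ := fun j =>
    ((Lp.stronglyMeasurable (A j)).measurable.pow_const 2).ennreal_ofReal.aemeasurable
  have h1 : ∫⁻ ω, ∑' j, ENNReal.ofReal ((A j ω) ^ 2) ∂μ ≠ ⊤ := by
    rw [lintegral_tsum hme]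
    have h2 : ∀ j, ∫⁻ ω, ENNReal.ofReal ((A j ω) ^ 2) ∂μ = ENNReal.ofReal (‖A j‖ ^ 2) := by
      intro j
      rw [norm_sq_L2, ofReal_integral_eq_lintegral_ofReal (Lp.memLp (A j)).integrable_sq
        (ae_of_all _ fun ω => sq_nonneg _)]
    simp_rw [h2]
    exact hA.tsum_ofReal_ne_top
  filter_upwards [ae_lt_top' (AEMeasurable.ennreal_tsum hme) h1] with ω hω
  have h3 := ENNReal.tendsto_atTop_zero_of_tsum_ne_top hω.ne
  have h4 := (ENNReal.tendsto_toReal ENNReal.zero_ne_top).comp h3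
  have h5 : Tendsto (fun j => (A j ω) ^ 2) atTop (𝓝 0) := by
    refine h4.congr fun j => ?_
    exact ENNReal.toReal_ofReal (sq_nonneg _)
  have h6 := (Real.continuous_sqrt.tendsto 0).comp h5
  rw [Real.sqrt_zero] at h6
  refine (tendsto_zero_iff_abs_tendsto_zero _).2 (h6.congr fun j => ?_)
  exact Real.sqrt_sq_eq_abs _

lemma coe_sum (Z : ℕ → Lp ℝ 2 μ) (n : ℕ) :
    ∀ᵐ ω ∂μ, (∑ i ∈ Finset.range n, Z i : Lp ℝ 2 μ) ω = ∑ i ∈ Finset.range n, Z i ω := by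
  induction n with
  | zero =>
    simp only [Finset.range_zero, Finset.sum_empty]
    exact Lp.coeFn_zero ℝ 2 μ
  | succ n ih =>
    simp only [Finset.sum_range_succ]
    filter_upwards [ih, Lp.coeFn_add (∑ i ∈ Finset.range n, Z i) (Z n)] with ω h1 h2
    rw [h2, Pi.add_apply, h1]

lemma core (F : ℕ → Ω → ℝ) (hm : ∀ n, Measurable (F n)) (hi : ∀ n, Integrable (F n) μ)
    (h0 : ∀ n ω, 0 ≤ F n ω) (M : ℝ) (hM : ∀ n, ∫ ω, F n ω ∂μ ≤ M) :
    ∃ φ : ℕ → ℕ, StrictMono φ ∧ ∃ g : Ω → ℝ, Integrable g μ ∧ ∀ ψ : ℕ → ℕ, StrictMono ψ →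
      ∀ᵐ ω ∂μ, Tendsto (fun n : ℕ => (n : ℝ)⁻¹ * ∑ i ∈ Finset.range n, F (φ (ψ i)) ω)
        atTop (𝓝 (g ω)) := by
  obtain ⟨φ, G, p, hφ, hp0, hps, htail, hcross, hGn, hG0, hGm, hGM⟩ := construct F hm hi h0 M hM
  obtain ⟨g, hg, hGg⟩ := mono_limit (fun k => G k) (fun k => Lp_integrable _) hG0 hGm M hGM
  refine ⟨φ, hφ, g, hg, fun ψ hψ => ?_⟩
  have hψi : ∀ i, i ≤ ψ i := fun i => hψ.le_apply
  let Z : ℕ → Lp ℝ 2 μ := fun i => tr μ F hm h0 (φ (ψ i)) i - G i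
  have hZn : ∀ i, ‖Z i‖ ^ 2 ≤ 4 * vb p i := by
    intro i
    have h1 : ‖tr μ F hm h0 (φ (ψ i)) i‖ ^ 2 ≤ vb p i :=
      (tr_norm F hm h0 _ i).trans (vb_le_vb _ _ _ fun l hl =>
        htail (ψ i) l (hl.le.trans (hψi i)))
    have h2 := hGn i
    have h3 : ‖Z i‖ ≤ ‖tr μ F hm h0 (φ (ψ i)) i‖ + ‖G i‖ := norm_sub_le _ _
    have h4 := norm_nonneg (Z i)
    nlinarith [sq_nonneg (‖tr μ F hm h0 (φ (ψ i)) i‖ - ‖G i‖)]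
  have hZc : ∀ i j, i < j → |inner ℝ (Z i) (Z j)| ≤ 1 / ((j : ℝ) + 1) := by
    intro i j hij
    refine (hcross (ψ i) (ψ j) i j (hψ hij) (hψi i) (hψi j)).trans ?_
    refine one_div_le_one_div_of_le (by positivity) ?_
    have : (j : ℝ) ≤ ψ j := by exact_mod_cast hψi j
    linarith
  have hS := norm_sum_sq_le Z (fun i => 4 * vb p i)
    ((vb_mono p hp0).const_mul (by norm_num)) hZn hZc
  -- convergence along geometric subsequences
  have hgeo : ∀ c : ℝ, 1 < c → ∀ᵐ ω ∂μ, Tendsto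
      (fun j : ℕ => (⌊c ^ j⌋₊ : ℝ)⁻¹ * ∑ i ∈ Finset.range ⌊c ^ j⌋₊, Z i ω) atTop (𝓝 0) := by
    intro c hc
    have h1 := ae_tendsto_zero (μ := μ)
      (fun j : ℕ => (⌊c ^ j⌋₊ : ℝ)⁻¹ • ∑ i ∈ Finset.range ⌊c ^ j⌋₊, Z i) (by
        refine Summable.of_nonneg_of_le (fun j => sq_nonneg _) (fun j => ?_)
          (((vb_summable p hp0 hps c hc).mul_left 4).add ((inv_summable c hc).mul_left 2))
        have h1 : 1 ≤ ⌊c ^ j⌋₊ := Nat.le_floor (by simpa using one_le_pow₀ hc.le)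
        have h2 : (0 : ℝ) < ⌊c ^ j⌋₊ := by exact_mod_cast h1
        rw [norm_smul, mul_pow, Real.norm_of_nonneg (by positivity)]
        calc _ ≤ ((⌊c ^ j⌋₊ : ℝ)⁻¹) ^ 2 * (⌊c ^ j⌋₊ * (4 * vb p ⌊c ^ j⌋₊ + 2)) := by
              gcongr
              exact hS _
          _ = _ := by field_simp)
    have h2 : ∀ᵐ ω ∂μ, ∀ n, (∑ i ∈ Finset.range n, Z i : Lp ℝ 2 μ) ω =
        ∑ i ∈ Finset.range n, Z i ω := ae_all_iff.2 fun n => coe_sum Z n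
    have h3 : ∀ᵐ ω ∂μ, ∀ j : ℕ, ((⌊c ^ j⌋₊ : ℝ)⁻¹ • ∑ i ∈ Finset.range ⌊c ^ j⌋₊, Z i : Lp ℝ 2 μ) ω
        = (⌊c ^ j⌋₊ : ℝ)⁻¹ * (∑ i ∈ Finset.range ⌊c ^ j⌋₊, Z i : Lp ℝ 2 μ) ω :=
      ae_all_iff.2 fun j => by
        filter_upwards [Lp.coeFn_smul (⌊c ^ j⌋₊ : ℝ)⁻¹ (∑ i ∈ Finset.range ⌊c ^ j⌋₊, Z i)] with ω h
        rw [h]; rfl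
    filter_upwards [h1, h2, h3] with ω h1 h2 h3
    refine h1.congr fun j => ?_
    rw [h3, h2]
  let c : ℕ → ℝ := fun k => 1 + 1 / ((k : ℝ) + 1)
  have hc1 : ∀ k, 1 < c k := fun k => by
    have : (0 : ℝ) < 1 / ((k : ℝ) + 1) := by positivity
    simp only [c]; linarith
  have hclim : Tendsto c atTop (𝓝 1) := by
    simpa [c] using (tendsto_one_div_add_atTop_nhds_zero_nat (𝕜 := ℝ)).const_add 1
  have hZcoe : ∀ᵐ ω ∂μ, ∀ i, Z i ω = min (F (φ (ψ i)) ω) i - G i ω :=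
    ae_all_iff.2 fun i => by
      filter_upwards [Lp.coeFn_sub (tr μ F hm h0 (φ (ψ i)) i) (G i),
        tr_coe F hm h0 (φ (ψ i)) i] with ω h1 h2
      rw [h1, Pi.sub_apply, h2]
  have hBC : ∀ᵐ ω ∂μ, ∀ᶠ i : ℕ in atTop, ω ∉ {ω | (i : ℝ) < F (φ (ψ i)) ω} := by
    refine ae_eventually_notMem ?_
    refine ne_top_of_le_ne_top hps.tsum_ofReal_ne_top (ENNReal.tsum_le_tsum fun i => ?_)
    rw [← ofReal_measureReal]
    exact ENNReal.ofReal_le_ofReal (htail (ψ i) i (hψi i))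
  filter_upwards [ae_all_iff.2 fun k => hgeo (c k) (hc1 k), hZcoe, hBC, hGg] with ω h1 h2 h3 h4
  have hG' := h4.cesaro
  -- truncated averages
  have hT : Tendsto (fun n : ℕ => (∑ i ∈ Finset.range n, min (F (φ (ψ i)) ω) (i : ℝ)) / (n : ℝ))
      atTop (𝓝 (g ω)) := by
    refine tendsto_div_of_monotone_of_tendsto_div_floor_pow
      (fun n => ∑ i ∈ Finset.range n, min (F (φ (ψ i)) ω) (i : ℝ)) (g ω) ?_ c hc1 hclim ?_
    · refine monotone_nat_of_le_succ fun n => ?_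
      rw [Finset.sum_range_succ]
      have : 0 ≤ min (F (φ (ψ n)) ω) (n : ℝ) := le_min (h0 _ _) (by positivity)
      linarith
    · intro k
      have hfl : Tendsto (fun j : ℕ => ⌊c k ^ j⌋₊) atTop atTop :=
        tendsto_nat_floor_atTop.comp (tendsto_pow_atTop_atTop_of_one_lt (hc1 k))
      have h5 := (h1 k).add (hG'.comp hfl)
      rw [zero_add] at h5
      refine h5.congr fun j => ?_
      simp only [Function.comp_apply, h2]
      rw [Finset.sum_sub_distrib]
      ring
  have hD : Tendsto (fun i : ℕ => F (φ (ψ i)) ω - min (F (φ (ψ i)) ω) (i : ℝ)) atTop (𝓝 0) := by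
    refine tendsto_const_nhds.congr' ?_
    filter_upwards [h3] with i hi
    simp only [not_lt] at hi
    rw [min_eq_left hi, sub_self]
  have h6 := hT.add hD.cesaro
  rw [add_zero] at h6
  refine h6.congr fun n => ?_
  rw [Finset.sum_sub_distrib]
  ring

end meas

end Komlos

/-- **Komlós' Theorem.** For a probability measure `μ` and a norm-bounded sequence `(f n)`
in `L¹(μ)`, there are a subsequence (given by a strictly increasing `φ : ℕ → ℕ`) and a
function `g ∈ L¹(μ)` such that the Cesàro means of every further subsequence converge to
`g` almost everywhere. -/
theorem komlos_theorem {Ω : Type*} [MeasurableSpace Ω] (μ : Measure Ω)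
    [IsProbabilityMeasure μ] (f : ℕ → Lp ℝ 1 μ) (hbdd : ∃ M : ℝ, ∀ n, ‖f n‖ ≤ M) :
    ∃ φ : ℕ → ℕ, StrictMono φ ∧ ∃ g : Lp ℝ 1 μ,
      ∀ ψ : ℕ → ℕ, StrictMono ψ →
        ∀ᵐ ω ∂μ, Tendsto
          (fun n : ℕ => (1 / (n : ℝ)) * ∑ i ∈ Finset.range n, (f (φ (ψ i)) : Ω → ℝ) ω)
          atTop (𝓝 ((g : Ω → ℝ) ω)) := by
  obtain ⟨M, hM⟩ := hbdd
  have hfm : ∀ n, Measurable (f n : Ω → ℝ) := fun n => (Lp.stronglyMeasurable (f n)).measurable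
  have hfi : ∀ n, Integrable (f n : Ω → ℝ) μ := fun n => L1.integrable_coeFn (f n)
  have hn : ∀ n, ∫ ω, |(f n : Ω → ℝ) ω| ∂μ ≤ M := fun n => by
    have := hM n
    rw [L1.norm_eq_integral_norm] at this
    exact this
  obtain ⟨φ₁, hφ₁, g₁, hg₁, H₁⟩ := Komlos.core (μ := μ) (fun n ω => max ((f n : Ω → ℝ) ω) 0)
    (fun n => (hfm n).max measurable_const) (fun n => (hfi n).pos_part)
    (fun n ω => le_max_right _ _) M
    (fun n => (integral_mono (hfi n).pos_part (hfi n).abs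
      fun ω => max_le (le_abs_self _) (abs_nonneg _)).trans (hn n))
  obtain ⟨φ₂, hφ₂, g₂, hg₂, H₂⟩ := Komlos.core (μ := μ)
    (fun n ω => max (-(f (φ₁ n) : Ω → ℝ) ω) 0)
    (fun n => (hfm (φ₁ n)).neg.max measurable_const) (fun n => (hfi (φ₁ n)).neg_part)
    (fun n ω => le_max_right _ _) M
    (fun n => (integral_mono (hfi (φ₁ n)).neg_part (hfi (φ₁ n)).abs
      fun ω => max_le (neg_le_abs _) (abs_nonneg _)).trans (hn (φ₁ n)))
  refine ⟨φ₁ ∘ φ₂, hφ₁.comp hφ₂, (hg₁.sub hg₂).toL1 _, fun ψ hψ => ?_⟩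
  filter_upwards [H₁ (φ₂ ∘ ψ) (hφ₂.comp hψ), H₂ ψ hψ, (hg₁.sub hg₂).coeFn_toL1] with ω h1 h2 h3
  rw [h3]
  refine (h1.sub h2).congr fun n => ?_
  rw [← mul_sub, ← Finset.sum_sub_distrib, one_div]
  congr 1
  refine Finset.sum_congr rfl fun i _ => ?_
  simp only [Function.comp_apply]
  rcases le_total 0 ((f (φ₁ (φ₂ (ψ i))) : Ω → ℝ) ω) with h | h
  · rw [max_eq_left h, max_eq_right (by linarith), sub_zero]
  · rw [max_eq_right h, max_eq_left (by linarith)]; ring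
end

section
/- Let B denote the closed unit ball of L¹[0,1] and let L < 2. Then every affine uniformly L-Lipschitzian map T : B → B (i.e., ‖Tⁿf − Tⁿg‖₁ ≤ L‖f − g‖₁ for all f, g ∈ B and all n ∈ ℕ) has a fixed point in B. -/
open MeasureTheory Filter Metric Topology

/-- Lebesgue measure on `[0,1]`. -/
noncomputable def μ01 : Measure ℝ := volume.restrict (Set.Icc 0 1)

section AuxLemmas

theorem aux_min {X : Type*} [AddCommGroup X] [Module ℝ X] (D : ℕ → Set X) (hD : Antitone D)
    (hc : ∀ n, Convex ℝ (D n)) (hne : ∀ n, (D n).Nonempty) (F : X → ℝ) (M : ℝ)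
    (h0 : ∀ x ∈ D 0, 0 ≤ F x) (hM : ∀ x ∈ D 0, F x ≤ M) :
    ∃ z : ℕ → X, ∃ e : ℕ → ℝ, (∀ n, z n ∈ D n) ∧ Tendsto e atTop (𝓝 0) ∧
      ∀ n m, n ≤ m → (F (z n) + F (z m)) / 2 - F ((1/2 : ℝ) • z n + (1/2 : ℝ) • z m) ≤ e n := by
  have hbd : ∀ n, BddBelow (F '' D n) := fun n => ⟨0, by
    rintro _ ⟨x, hx, rfl⟩; exact h0 x (hD (Nat.zero_le n) hx)⟩
  set J : ℕ → ℝ := fun n => sInf (F '' D n) with hJ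
  have hJm : Monotone J := fun n m h =>
    csInf_le_csInf (hbd n) ((hne m).image F) (Set.image_mono (hD h))
  have hJle : ∀ n, ∀ x ∈ D n, J n ≤ F x := fun n x hx => csInf_le (hbd n) ⟨x, hx, rfl⟩
  have hJb : BddAbove (Set.range J) := ⟨M, by
    rintro _ ⟨n, rfl⟩
    obtain ⟨x, hx⟩ := hne n
    exact (hJle n x hx).trans (hM x (hD (Nat.zero_le n) hx))⟩
  have hex : ∀ n : ℕ, ∃ z ∈ D n, F z < J n + 1 / ((n : ℝ) + 1) := fun n => by
    have : sInf (F '' D n) < J n + 1 / ((n : ℝ) + 1) := by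
      have : (0:ℝ) < 1 / ((n : ℝ) + 1) := by positivity
      simp only [hJ]; linarith
    obtain ⟨_, ⟨x, hx, rfl⟩, h⟩ := exists_lt_of_csInf_lt ((hne n).image F) this
    exact ⟨x, hx, h⟩
  choose z hz hFz using hex
  refine ⟨z, fun n => ((⨆ i, J i) - J n) / 2 + 1 / ((n : ℝ) + 1), hz, ?_, ?_⟩
  · have h1 := tendsto_atTop_ciSup hJm hJb
    have h2 := (((tendsto_const_nhds (x := ⨆ i, J i)).sub h1).div_const 2).add
      (tendsto_one_div_add_atTop_nhds_zero_nat (𝕜 := ℝ))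
    simpa using h2
  · intro n m h
    have h1 := hJle n _ (hc n (hz n) (hD h (hz m)) (a := 1/2) (b := 1/2)
      (by norm_num) (by norm_num) (by norm_num))
    have h2 := hFz n
    have h3 := hFz m
    have h4 : J m ≤ ⨆ i, J i := le_ciSup hJb m
    have h5 : 1 / ((m : ℝ) + 1) ≤ 1 / ((n : ℝ) + 1) := by
      gcongr
    linarith

set_option linter.unusedSectionVars false

variable {Ω : Type*} [MeasurableSpace Ω] {μ : Measure Ω} [IsFiniteMeasure μ]

theorem aux_memLp (a : Lp ℝ 1 μ) (ha : 0 ≤ a) (c : ℝ) (hc : 0 ≤ c) (p : ENNReal) :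
    MemLp (fun x => Real.exp (-(c * a x))) p μ := by
  refine MemLp.of_bound ?_ 1 ?_
  · exact Real.continuous_exp.comp_aestronglyMeasurable
      ((Lp.aestronglyMeasurable a).const_mul c).neg
  · filter_upwards [(Lp.coeFn_nonneg a).2 ha] with x hx
    rw [Real.norm_eq_abs, Real.abs_exp, Real.exp_le_one_iff]
    have : 0 ≤ a x := hx
    have := mul_nonneg hc this
    linarith

theorem aux_smul_nonneg (c : ℝ) (hc : 0 ≤ c) (a : Lp ℝ 1 μ) (ha : 0 ≤ a) : 0 ≤ c • a := by
  rw [← Lp.coeFn_nonneg] at ha ⊢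
  filter_upwards [ha, Lp.coeFn_smul c a] with x hx h
  rw [h]
  exact mul_nonneg hc hx

noncomputable def auxE (a : Lp ℝ 1 μ) : ℝ := ∫ x, Real.exp (-(1 * a x)) ∂μ

theorem auxE_nonneg (a : Lp ℝ 1 μ) : 0 ≤ auxE a :=
  integral_nonneg fun _ => (Real.exp_pos _).le

theorem auxE_le (a : Lp ℝ 1 μ) (ha : 0 ≤ a) : auxE a ≤ μ.real Set.univ := by
  have : ∫ _ : Ω, (1 : ℝ) ∂μ = μ.real Set.univ := by simp
  rw [← this]
  refine integral_mono_ae (memLp_one_iff_integrable.1 (aux_memLp a ha 1 zero_le_one 1))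
    (integrable_const _) ?_
  filter_upwards [(Lp.coeFn_nonneg a).2 ha] with x hx
  have : 0 ≤ a x := hx
  rw [Real.exp_le_one_iff]; linarith

noncomputable def auxU (a : Lp ℝ 1 μ) (ha : 0 ≤ a) : Lp ℝ 2 μ :=
  (aux_memLp a ha (1/2) (by norm_num) 2).toLp _

theorem aux_defect (a b : Lp ℝ 1 μ) (ha : 0 ≤ a) (hb : 0 ≤ b) :
    (auxE a + auxE b) / 2 - auxE ((1/2 : ℝ) • a + (1/2 : ℝ) • b)
      = (1/2) * ‖auxU a ha - auxU b hb‖ ^ 2 := by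
  have hm : 0 ≤ (1/2 : ℝ) • a + (1/2 : ℝ) • b :=
    add_nonneg (aux_smul_nonneg _ (by norm_num) a ha) (aux_smul_nonneg _ (by norm_num) b hb)
  have i1 := (memLp_one_iff_integrable.1 (aux_memLp a ha 1 zero_le_one 1))
  have i2 := (memLp_one_iff_integrable.1 (aux_memLp b hb 1 zero_le_one 1))
  have i3 := (memLp_one_iff_integrable.1 (aux_memLp _ hm 1 zero_le_one 1))
  have i4 : Integrable (fun x => (Real.exp (-(1 * a x)) + Real.exp (-(1 * b x))) / 2) μ :=
    (i1.add i2).div_const 2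
  rw [← real_inner_self_eq_norm_sq, L2.inner_def]
  simp only [auxE]
  rw [← integral_add i1 i2, ← integral_div, ← integral_sub i4 i3,
    ← integral_const_mul]
  refine integral_congr_ae ?_
  filter_upwards [Lp.coeFn_sub (auxU a ha) (auxU b hb), MemLp.coeFn_toLp
    (aux_memLp a ha (1/2) (by norm_num) 2), MemLp.coeFn_toLp
    (aux_memLp b hb (1/2) (by norm_num) 2), Lp.coeFn_add ((1/2 : ℝ) • a) ((1/2 : ℝ) • b),
    Lp.coeFn_smul (1/2 : ℝ) a, Lp.coeFn_smul (1/2 : ℝ) b] with x h1 h2 h3 h4 h5 h6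
  have h2' : auxU a ha x = Real.exp (-(1/2 * a x)) := h2
  have h3' : auxU b hb x = Real.exp (-(1/2 * b x)) := h3
  rw [h1, h4]
  simp only [Pi.sub_apply, Pi.add_apply, h2', h3', h5, h6, Pi.smul_apply, smul_eq_mul,
    real_inner_self_eq_norm_sq, Real.norm_eq_abs, sq_abs]
  have e1 : Real.exp (-(1 * a x)) = Real.exp (-(1/2 * a x)) ^ 2 := by
    rw [← Real.exp_nat_mul]; congr 1; push_cast; ring
  have e2 : Real.exp (-(1 * b x)) = Real.exp (-(1/2 * b x)) ^ 2 := by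
    rw [← Real.exp_nat_mul]; congr 1; push_cast; ring
  have e3 : Real.exp (-(1 * (1/2 * a x + 1/2 * b x))) =
      Real.exp (-(1/2 * a x)) * Real.exp (-(1/2 * b x)) := by
    rw [← Real.exp_add]; congr 1; ring
  rw [e1, e2, e3]; ring

theorem aux_subseq (a : ℕ → Lp ℝ 1 μ) (ha : ∀ n, 0 ≤ a n) (hn : ∀ n, ‖a n‖ ≤ 1) (e : ℕ → ℝ)
    (he : Tendsto e atTop (𝓝 0))
    (hd : ∀ n m, n ≤ m → (auxE (a n) + auxE (a m)) / 2
      - auxE ((1/2 : ℝ) • a n + (1/2 : ℝ) • a m) ≤ e n) :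
    ∃ φ : ℕ → ℕ, StrictMono φ ∧ ∃ α : Ω → ℝ,
      ∀ᵐ x ∂μ, Tendsto (fun n => a (φ n) x) atTop (𝓝 (α x)) := by
  have hC : CauchySeq (fun n => auxU (a n) (ha n)) := by
    rw [Metric.cauchySeq_iff']
    intro ε hε
    have : ∀ᶠ n in atTop, e n < ε ^ 2 / 2 := he.eventually (gt_mem_nhds (by positivity))
    obtain ⟨N, hN⟩ := this.exists
    refine ⟨N, fun n hn => ?_⟩
    have h1 := hd N n hn
    rw [aux_defect _ _ (ha N) (ha n)] at h1
    rw [dist_comm, dist_eq_norm]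
    exact lt_of_pow_lt_pow_left₀ 2 hε.le (by linarith)
  obtain ⟨U, hU⟩ := cauchySeq_tendsto_of_complete hC
  obtain ⟨φ, hφ, hae⟩ := (tendstoInMeasure_of_tendsto_Lp hU).exists_seq_tendsto_ae
  refine ⟨φ, hφ, fun x => -2 * Real.log (U x), ?_⟩
  have hb := ae_bdd_liminf_atTop_of_eLpNorm_bdd (μ := μ) (p := 1) (R := 1) (f := fun n => a (φ n))
    one_ne_zero (fun n => (Lp.stronglyMeasurable _).measurable) (fun n => by
      have := hn (φ n)
      rw [Lp.norm_def] at this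
      simpa using (ENNReal.toReal_le_toReal (Lp.eLpNorm_ne_top _) ENNReal.one_ne_top).1 (by simpa using this))
  have hu : ∀ᵐ x ∂μ, ∀ n, auxU (a n) (ha n) x = Real.exp (-(1/2 * a n x)) :=
    ae_all_iff.2 fun n => MemLp.coeFn_toLp (aux_memLp (a n) (ha n) (1/2) (by norm_num) 2)
  filter_upwards [hae, hb, hu] with x h1 h2 h3
  have h4 : ∀ n, a (φ n) x = -2 * Real.log (auxU (a (φ n)) (ha (φ n)) x) := fun n => by
    rw [h3, Real.log_exp]; ring
  simp_rw [h4]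
  have hU0 : U x ≠ 0 := by
    intro h0
    rw [h0] at h1
    have h5 : Tendsto (fun n => a (φ n) x) atTop atTop := by
      simp_rw [h4]
      have : Tendsto (fun n => auxU (a (φ n)) (ha (φ n)) x) atTop (𝓝[>] 0) :=
        tendsto_nhdsWithin_iff.2 ⟨h1, Eventually.of_forall fun n => by
          rw [h3]; exact Real.exp_pos _⟩
      exact (tendsto_const_mul_atTop_of_neg (by norm_num)).2 (Real.tendsto_log_nhdsGT_zero.comp this)
    have h6 : Tendsto (fun n => ‖a (φ n) x‖ₑ) atTop (𝓝 ⊤) := by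
      rw [ENNReal.tendsto_nhds_top_iff_nat]
      intro k
      filter_upwards [h5.eventually_gt_atTop (k : ℝ)] with n hn
      rw [← ofReal_norm, Real.norm_eq_abs]
      rw [← ENNReal.ofReal_natCast]
      exact (ENNReal.ofReal_lt_ofReal_iff_of_nonneg (by positivity)).2 (hn.trans_le (le_abs_self _))
    rw [h6.liminf_eq] at h2
    exact lt_irrefl _ h2
  exact (h1.log hU0).const_mul _

theorem aux_brezis (g : ℕ → Lp ℝ 1 μ) (h y : Lp ℝ 1 μ)
    (hae : ∀ᵐ x ∂μ, Tendsto (fun n => g n x) atTop (𝓝 (h x))) :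
    Tendsto (fun n => ‖g n - y‖ - ‖g n - h‖) atTop (𝓝 ‖h - y‖) := by
  have e : ∀ u v : Lp ℝ 1 μ, ‖u - v‖ = ∫ x, ‖u x - v x‖ ∂μ := fun u v => by
    rw [L1.norm_eq_integral_norm]
    exact integral_congr_ae <| (Lp.coeFn_sub _ _).fun_comp norm
  have i : ∀ u v : Lp ℝ 1 μ, Integrable (fun x => ‖u x - v x‖) μ := fun u v =>
    ((L1.integrable_coeFn u).sub (L1.integrable_coeFn v)).norm
  simp_rw [e]
  simp_rw [← integral_sub (i _ _) (i _ _)]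
  refine tendsto_integral_of_dominated_convergence (fun x => ‖h x - y x‖)
    (fun n => ((i _ _).sub (i _ _)).aestronglyMeasurable) (i _ _) (fun n => ?_) ?_
  · refine Eventually.of_forall fun x => ?_
    have := abs_norm_sub_norm_le (g n x - y x) (g n x - h x)
    simpa using this
  · filter_upwards [hae] with x hx
    have := ((hx.sub_const (y x)).norm).sub ((hx.sub_const (h x)).norm)
    simpa using this

theorem aux_key (C : ℕ → Set (Lp ℝ 1 μ)) (hC : Antitone C) (hc : ∀ n, Convex ℝ (C n))
    (hne : ∀ n, (C n).Nonempty) (hB : ∀ n, C n ⊆ closedBall 0 1) :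
    ∃ g : ℕ → Lp ℝ 1 μ, ∃ h : Lp ℝ 1 μ, ∃ r : ℝ, (∀ n, g n ∈ C n) ∧ h ∈ closedBall 0 1 ∧
      ∀ y, Tendsto (fun n => ‖g n - y‖) atTop (𝓝 (r + ‖h - y‖)) := by
  let D : ℕ → Set (Lp ℝ 1 μ × Lp ℝ 1 μ) := fun n =>
    {p | (0 ≤ p.1 ∧ 0 ≤ p.2) ∧ (p.1 ∈ closedBall 0 1 ∧ p.2 ∈ closedBall 0 1) ∧ p.1 - p.2 ∈ C n}
  have hDa : Antitone D := fun n m h p hp => ⟨hp.1, hp.2.1, hC h hp.2.2⟩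
  have hDc : ∀ n, Convex ℝ (D n) := by
    rintro n p ⟨⟨p1, p2⟩, ⟨p3, p4⟩, p5⟩ q ⟨⟨q1, q2⟩, ⟨q3, q4⟩, q5⟩ a b ha hb hab
    refine ⟨⟨add_nonneg (aux_smul_nonneg a ha _ p1) (aux_smul_nonneg b hb _ q1),
      add_nonneg (aux_smul_nonneg a ha _ p2) (aux_smul_nonneg b hb _ q2)⟩,
      ⟨convex_closedBall _ _ p3 q3 ha hb hab, convex_closedBall _ _ p4 q4 ha hb hab⟩, ?_⟩
    have := hc n p5 q5 ha hb hab
    convert this using 1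
    simp only [Prod.fst_add, Prod.snd_add, Prod.smul_fst, Prod.smul_snd, smul_sub]
    abel
  have hDne : ∀ n, (D n).Nonempty := by
    intro n
    obtain ⟨z, hz⟩ := hne n
    have hz1 : ‖z‖ ≤ 1 := by simpa using hB n hz
    refine ⟨(z⁺, z⁻), ⟨posPart_nonneg z, negPart_nonneg z⟩, ⟨?_, ?_⟩, ?_⟩
    · rw [mem_closedBall_zero_iff]
      refine le_trans (norm_le_norm_of_abs_le_abs ?_) hz1
      rw [abs_of_nonneg (posPart_nonneg z), ← posPart_add_negPart]
      exact le_add_of_nonneg_right (negPart_nonneg z)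
    · rw [mem_closedBall_zero_iff]
      refine le_trans (norm_le_norm_of_abs_le_abs ?_) hz1
      rw [abs_of_nonneg (negPart_nonneg z), ← posPart_add_negPart]
      exact le_add_of_nonneg_left (posPart_nonneg z)
    · simpa only [posPart_sub_negPart] using hz
  obtain ⟨z, e, hz, he, hd⟩ := aux_min D hDa hDc hDne (fun p => auxE p.1 + auxE p.2)
    (μ.real Set.univ + μ.real Set.univ)
    (fun p _ => add_nonneg (auxE_nonneg _) (auxE_nonneg _))
    (fun p hp => add_le_add (auxE_le _ hp.1.1) (auxE_le _ hp.1.2))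
  have hd1 : ∀ n m, n ≤ m → (auxE (z n).1 + auxE (z m).1) / 2
      - auxE ((1/2 : ℝ) • (z n).1 + (1/2 : ℝ) • (z m).1) ≤ e n := by
    intro n m h
    have h1 := hd n m h
    have h2 := aux_defect _ _ (hz n).1.2 (hz m).1.2
    have h3 : 0 ≤ (1/2) * ‖auxU _ (hz n).1.2 - auxU _ (hz m).1.2‖ ^ 2 := by positivity
    simp only [Prod.fst_add, Prod.snd_add, Prod.smul_fst, Prod.smul_snd] at h1
    linarith
  have hd2 : ∀ n m, n ≤ m → (auxE (z n).2 + auxE (z m).2) / 2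
      - auxE ((1/2 : ℝ) • (z n).2 + (1/2 : ℝ) • (z m).2) ≤ e n := by
    intro n m h
    have h1 := hd n m h
    have h2 := aux_defect _ _ (hz n).1.1 (hz m).1.1
    have h3 : 0 ≤ (1/2) * ‖auxU _ (hz n).1.1 - auxU _ (hz m).1.1‖ ^ 2 := by positivity
    simp only [Prod.fst_add, Prod.snd_add, Prod.smul_fst, Prod.smul_snd] at h1
    linarith
  obtain ⟨φ, hφ, α, hα⟩ := aux_subseq (fun n => (z n).1) (fun n => (hz n).1.1)
    (fun n => by simpa using (hz n).2.1.1) e he hd1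
  obtain ⟨ψ, hψ, β, hβ⟩ := aux_subseq (fun n => (z (φ n)).2) (fun n => (hz _).1.2)
    (fun n => by simpa using (hz _).2.1.2) (e ∘ φ) (he.comp hφ.tendsto_atTop)
    (fun n m h => hd2 _ _ (hφ.monotone h))
  let g : ℕ → Lp ℝ 1 μ := fun n => (z (φ (ψ n))).1 - (z (φ (ψ n))).2
  have hgC : ∀ n, g n ∈ C n := fun n =>
    hC (hψ.le_apply.trans hφ.le_apply) (hz (φ (ψ n))).2.2
  have hgn : ∀ n, ‖g n‖ ≤ 1 := fun n => by simpa using hB n (hgC n)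
  have hgae : ∀ᵐ x ∂μ, Tendsto (fun n => g n x) atTop (𝓝 (α x - β x)) := by
    have hs : ∀ᵐ x ∂μ, ∀ n, g n x = (z (φ (ψ n))).1 x - (z (φ (ψ n))).2 x :=
      ae_all_iff.2 fun n => Lp.coeFn_sub _ _
    filter_upwards [hα, hβ, hs] with x h1 h2 h3
    simp_rw [h3]
    exact (h1.comp hψ.tendsto_atTop).sub h2
  have hle : eLpNorm (fun x => α x - β x) 1 μ ≤ 1 := by
    refine Lp.eLpNorm_le_of_ae_tendsto (Eventually.of_forall fun n => ?_)
      (fun n => Lp.aestronglyMeasurable (g n)) hgae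
    have := hgn n
    rw [Lp.norm_def] at this
    exact (ENNReal.toReal_le_toReal (Lp.eLpNorm_ne_top _) ENNReal.one_ne_top).1 (by simpa using this)
  have hmem : MemLp (fun x => α x - β x) 1 μ :=
    ⟨aestronglyMeasurable_of_tendsto_ae atTop (fun n => Lp.aestronglyMeasurable (g n)) hgae,
      hle.trans_lt ENNReal.one_lt_top⟩
  let h : Lp ℝ 1 μ := hmem.toLp _
  have hh : ‖h‖ ≤ 1 := by
    rw [Lp.norm_toLp]
    exact ENNReal.toReal_le_of_le_ofReal zero_le_one (by simpa using hle)
  have hgh : ∀ᵐ x ∂μ, Tendsto (fun n => g n x) atTop (𝓝 (h x)) := by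
    filter_upwards [hgae, hmem.coeFn_toLp] with x h1 h2
    rw [h2]; exact h1
  obtain ⟨r, -, χ, hχ, hr⟩ := tendsto_subseq_of_bounded (Metric.isBounded_Icc (0:ℝ) 2)
    (x := fun n => ‖g n - h‖) (fun n => ⟨norm_nonneg _, by
      have := norm_sub_le (g n) h
      linarith [hgn n]⟩)
  refine ⟨fun n => g (χ n), h, r, fun n => hC hχ.le_apply (hgC _), by simpa using hh, fun y => ?_⟩
  have h1 := ((aux_brezis g h y hgh).comp hχ.tendsto_atTop)
  have h2 := hr.add h1
  simpa [Function.comp_def] using h2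

theorem aux_fix {E : Type*} [NormedAddCommGroup E] [NormedSpace ℝ E] [CompleteSpace E]
    (hA : ∀ C : ℕ → Set E, Antitone C → (∀ n, Convex ℝ (C n)) → (∀ n, (C n).Nonempty) →
      (∀ n, C n ⊆ closedBall 0 1) →
      ∃ g : ℕ → E, ∃ h : E, ∃ r : ℝ, (∀ n, g n ∈ C n) ∧ h ∈ closedBall 0 1 ∧
        ∀ y, Tendsto (fun n => ‖g n - y‖) atTop (𝓝 (r + ‖h - y‖)))
    (L : ℝ) (hL1 : 1 ≤ L) (hL : L < 2) (T : E → E)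
    (hmaps : Set.MapsTo T (closedBall (0 : E) 1) (closedBall (0 : E) 1))
    (haff : ∀ x ∈ closedBall (0 : E) 1, ∀ y ∈ closedBall (0 : E) 1, ∀ l : ℝ, 0 ≤ l → l ≤ 1 →
      T (l • x + (1 - l) • y) = l • T x + (1 - l) • T y)
    (hlip : ∀ n : ℕ, ∀ f ∈ closedBall (0 : E) 1, ∀ g ∈ closedBall (0 : E) 1,
      ‖T^[n] f - T^[n] g‖ ≤ L * ‖f - g‖) :
    ∃ f ∈ closedBall (0 : E) 1, T f = f := by
  have hit : ∀ n, ∀ x ∈ closedBall (0 : E) 1, T^[n] x ∈ closedBall (0 : E) 1 :=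
    fun n x hx => hmaps.iterate n hx
  -- Cesaro means
  have hces : ∀ x ∈ closedBall (0 : E) 1, ∀ d : ℝ, (∀ k, ‖T^[k] x - x‖ ≤ d) → ∀ n : ℕ,
      ∃ c ∈ closedBall (0 : E) 1, ‖c - x‖ ≤ d ∧
        ((n : ℝ) + 1) • (T c - c) = T^[n + 1] x - x := by
    intro x hx d hd n
    induction n with
    | zero => exact ⟨x, hx, by simpa using hd 0, by simp⟩
    | succ n ih =>
      obtain ⟨c, hc, hcd, hce⟩ := ih
      have hn : (0 : ℝ) < (n : ℝ) + 2 := by positivity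
      set l : ℝ := ((n : ℝ) + 1) / ((n : ℝ) + 2) with hl
      have hl0 : 0 ≤ l := by positivity
      have hl1 : l ≤ 1 := by rw [hl, div_le_one hn]; linarith
      have hl2 : ((n : ℝ) + 2) * l = n + 1 := by rw [hl]; field_simp
      have hl3 : ((n : ℝ) + 2) * (1 - l) = 1 := by rw [mul_sub, hl2]; ring
      have hy := hit (n + 1) x hx
      refine ⟨l • c + (1 - l) • T^[n + 1] x, convex_closedBall _ _ hc hy hl0 (by linarith)
        (by ring), ?_, ?_⟩
      · have h1 : c ∈ closedBall x d := by rwa [mem_closedBall, dist_eq_norm]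
        have h2 : T^[n + 1] x ∈ closedBall x d := by
          rw [mem_closedBall, dist_eq_norm]; exact hd _
        have := convex_closedBall x d h1 h2 hl0 (by linarith : 0 ≤ 1 - l) (by ring)
        rwa [mem_closedBall, dist_eq_norm] at this
      · rw [haff c hc _ hy l hl0 hl1, ← Function.iterate_succ_apply' T (n + 1) x]
        have e1 : l • T c + (1 - l) • T^[n + 1 + 1] x - (l • c + (1 - l) • T^[n + 1] x)
            = l • (T c - c) + (1 - l) • (T^[n + 1 + 1] x - T^[n + 1] x) := by
          simp only [smul_sub]; abel
        have e2 : (((n + 1 : ℕ) : ℝ) + 1) = (n : ℝ) + 2 := by push_cast; ring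
        rw [e1, e2, smul_add, smul_smul, smul_smul, hl2, hl3, hce, one_smul]
        abel
  -- one step
  have hstep : ∀ x ∈ closedBall (0 : E) 1, ∀ d : ℝ, (∀ k, ‖T^[k] x - x‖ ≤ d) →
      ∃ y ∈ closedBall (0 : E) 1, ‖y - x‖ ≤ d ∧ ∀ k, ‖T^[k] y - y‖ ≤ (L - 1) * d := by
    intro x hx d hd
    have hd0 : 0 ≤ d := (norm_nonneg _).trans (hd 0)
    obtain ⟨g, h, r, hg, hh, hlim⟩ := hA
      (fun n => {c | c ∈ closedBall (0 : E) 1 ∧ ‖c - x‖ ≤ d ∧ ‖T c - c‖ ≤ d / ((n : ℝ) + 1)})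
      (fun n m hnm c hc => ⟨hc.1, hc.2.1, hc.2.2.trans (by gcongr)⟩)
      (by
        rintro n p ⟨p1, p2, p3⟩ q ⟨q1, q2, q3⟩ a b ha hb hab
        obtain rfl : b = 1 - a := by linarith
        refine ⟨convex_closedBall _ _ p1 q1 ha hb hab, ?_, ?_⟩
        · rw [← dist_eq_norm, ← mem_closedBall] at p2 q2 ⊢
          exact convex_closedBall _ _ p2 q2 ha hb hab
        · rw [haff p p1 q q1 a ha (by linarith)]
          have e1 : a • T p + (1 - a) • T q - (a • p + (1 - a) • q)
            = a • (T p - p) + (1 - a) • (T q - q) := by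
            simp only [smul_sub]; abel
          rw [e1]
          rw [← mem_closedBall_zero_iff] at p3 q3 ⊢
          exact convex_closedBall _ _ p3 q3 ha hb hab)
      (by
        intro n
        obtain ⟨c, hc, hcd, hce⟩ := hces x hx d hd n
        refine ⟨c, hc, hcd, ?_⟩
        have hn : (0 : ℝ) < (n : ℝ) + 1 := by positivity
        rw [le_div_iff₀ hn, mul_comm]
        have := hd (n + 1)
        rw [← hce, norm_smul, Real.norm_of_nonneg hn.le] at this
        exact this)
      (fun n c hc => hc.1)
    have hrd : r + ‖h - x‖ ≤ d := le_of_tendsto (hlim x) (Eventually.of_forall fun n => (hg n).2.1)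
    have hrl : Tendsto (fun n => ‖g n - h‖) atTop (𝓝 r) := by simpa using hlim h
    have hr0 : 0 ≤ r := ge_of_tendsto hrl (Eventually.of_forall fun n => norm_nonneg _)
    refine ⟨h, hh, ?_, fun k => ?_⟩
    · rw [norm_sub_rev] at hrd ⊢
      rw [norm_sub_rev] at hrd ⊢
      linarith
    have hTk : ∀ k : ℕ, ∀ n : ℕ, ‖T^[k] (g n) - g n‖ ≤ k * (L * (d / ((n : ℝ) + 1))) := by
      intro k n
      induction k with
      | zero => simp
      | succ k ih =>
        have h1 := hlip k (T (g n)) (hmaps (hg n).1) (g n) (hg n).1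
        rw [← Function.iterate_succ_apply] at h1
        have h2 : L * ‖T (g n) - g n‖ ≤ L * (d / ((n : ℝ) + 1)) := by
          have := (hg n).2.2
          gcongr
        have h3 := norm_sub_le_norm_sub_add_norm_sub (T^[k+1] (g n)) (T^[k] (g n)) (g n)
        push_cast
        linarith
    have hle : ∀ n, ‖g n - T^[k] h‖ ≤ k * (L * (d / ((n : ℝ) + 1))) + L * ‖g n - h‖ := by
      intro n
      have h1 := hlip k (g n) (hg n).1 h hh
      have h2 := norm_sub_le_norm_sub_add_norm_sub (g n) (T^[k] (g n)) (T^[k] h)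
      have h3 := hTk k n
      rw [norm_sub_rev] at h3
      linarith
    have hR : Tendsto (fun n : ℕ => k * (L * (d / ((n : ℝ) + 1))) + L * ‖g n - h‖) atTop
        (𝓝 (k * (L * (d * 0)) + L * r)) := by
      have h0 := tendsto_one_div_add_atTop_nhds_zero_nat (𝕜 := ℝ)
      have := (((h0.const_mul d).const_mul L).const_mul (k : ℝ)).add (hrl.const_mul L)
      refine this.congr fun n => ?_
      ring
    have hfin := le_of_tendsto_of_tendsto' (hlim (T^[k] h)) hR hle
    rw [norm_sub_rev] at hfin
    have hrd' : r ≤ d := by linarith [norm_nonneg (h - x)]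
    nlinarith
  -- iteration
  let S := {p : E × ℝ // p.1 ∈ closedBall (0 : E) 1 ∧ ∀ k, ‖T^[k] p.1 - p.1‖ ≤ p.2}
  have hS : ∀ p : S, ∃ q : S, ‖q.1.1 - p.1.1‖ ≤ p.1.2 ∧ q.1.2 = (L - 1) * p.1.2 := by
    rintro ⟨⟨x, d⟩, hx, hd⟩
    obtain ⟨y, hy, hyx, hyd⟩ := hstep x hx d hd
    exact ⟨⟨⟨y, (L - 1) * d⟩, hy, hyd⟩, hyx, rfl⟩
  choose F hF1 hF2 using hS
  let p0 : S := ⟨(0, 1), by simp, fun k => by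
    have := hit k 0 (by simp)
    simpa using this⟩
  let s : ℕ → S := fun n => F^[n] p0
  have hs : ∀ n, s (n + 1) = F (s n) := fun n => Function.iterate_succ_apply' F n p0
  have hs2 : ∀ n, (s n).1.2 = 1 * (L - 1) ^ n := by
    intro n
    induction n with
    | zero => simp [s, p0]
    | succ n ih => rw [hs, hF2, ih]; ring
  have hcau : CauchySeq (fun n => (s n).1.1) := by
    refine cauchySeq_of_le_geometric (L - 1) 1 (by linarith) fun n => ?_
    rw [← hs2, dist_comm, dist_eq_norm, hs]
    exact hF1 _
  obtain ⟨f, hf⟩ := cauchySeq_tendsto_of_complete hcau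
  have hfB : f ∈ closedBall (0 : E) 1 :=
    isClosed_closedBall.mem_of_tendsto hf (Eventually.of_forall fun n => (s n).2.1)
  refine ⟨f, hfB, ?_⟩
  have hz : Tendsto (fun n => (L + 1) * ‖(s n).1.1 - f‖ + 1 * (L - 1) ^ n) atTop (𝓝 0) := by
    have h1 := (tendsto_iff_norm_sub_tendsto_zero.1 hf).const_mul (L + 1)
    have h2 := (tendsto_pow_atTop_nhds_zero_of_lt_one (by linarith : 0 ≤ L - 1)
      (by linarith)).const_mul 1
    simpa using h1.add h2
  have hb : ‖T f - f‖ ≤ 0 := by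
    refine ge_of_tendsto hz (Eventually.of_forall fun n => ?_)
    have h1 := hlip 1 f hfB (s n).1.1 (s n).2.1
    have h2 := (s n).2.2 1
    rw [hs2] at h2
    simp only [Function.iterate_one] at h1 h2
    have h3 := norm_sub_le_norm_sub_add_norm_sub (T f) (T (s n).1.1) f
    have h4 := norm_sub_le_norm_sub_add_norm_sub (T (s n).1.1) (s n).1.1 f
    rw [norm_sub_rev f] at h1
    linarith
  exact sub_eq_zero.1 (norm_le_zero_iff.1 hb)

end AuxLemmas

/-- For `L < 2`, every affine uniformly `L`-Lipschitzian self-map of the closed unit ball of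
`L¹[0,1]` has a fixed point. -/
theorem fixedPoint_unitBall_L1_uniformly_lipschitz
    (L : ℝ) (hL : L < 2)
    (T : Lp ℝ 1 μ01 → Lp ℝ 1 μ01)
    (hmaps : Set.MapsTo T (Metric.closedBall (0 : Lp ℝ 1 μ01) 1)
      (Metric.closedBall (0 : Lp ℝ 1 μ01) 1))
    (haff : ∀ x ∈ Metric.closedBall (0 : Lp ℝ 1 μ01) 1,
      ∀ y ∈ Metric.closedBall (0 : Lp ℝ 1 μ01) 1, ∀ l : ℝ, 0 ≤ l → l ≤ 1 →
      T (l • x + (1 - l) • y) = l • T x + (1 - l) • T y)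
    (hlip : ∀ n : ℕ, 1 ≤ n → ∀ f ∈ Metric.closedBall (0 : Lp ℝ 1 μ01) 1,
      ∀ g ∈ Metric.closedBall (0 : Lp ℝ 1 μ01) 1,
      ‖T^[n] f - T^[n] g‖ ≤ L * ‖f - g‖) :
    ∃ f ∈ Metric.closedBall (0 : Lp ℝ 1 μ01) 1, T f = f := by
  haveI : IsFiniteMeasure μ01 := by unfold μ01; infer_instance
  refine aux_fix (aux_key (μ := μ01)) (max L 1) (le_max_right _ _) (max_lt hL one_lt_two) T
    hmaps haff ?_
  intro n f hf g hg
  rcases Nat.eq_zero_or_pos n with rfl | hn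
  · simpa using le_mul_of_one_le_left (norm_nonneg (f - g)) (le_max_right L 1)
  · exact (hlip n hn f hf g hg).trans
      (mul_le_mul_of_nonneg_right (le_max_left _ _) (norm_nonneg _))
end

section
/- Let μ be a finite measure and let C be a norm-closed convex bounded subset of L¹(μ). Suppose there exists λ < 2 such that for every sequence (x_n) ⊆ C converging μ-almost everywhere to some x ∈ L¹(μ), one has inf_{c∈C} limsup_n ‖c − x_n‖₁ ≤ λ·limsup_n ‖x − x_n‖₁ (i.e., t(C) < 2). Then every affine nonexpansive map T : C → C (i.e., ‖Tf − Tg‖₁ ≤ ‖f − g‖₁ for all f, g ∈ C) has a fixed point. In other words, the failure of the fixed point property for affine nonexpansive mappings on closed convex bounded subsets of L¹(μ) can only occur when t(C) = 2. -/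
open MeasureTheory Filter Topology

noncomputable def psiFn (t : ℝ) : ℝ := t / √(1 + t ^ 2)

lemma psiFn_cont : Continuous psiFn := by
  unfold psiFn
  refine Continuous.div continuous_id (by fun_prop) (fun t => ?_)
  positivity

lemma psiFn_sq (t : ℝ) : psiFn t ^ 2 = t ^ 2 / (1 + t ^ 2) := by
  unfold psiFn
  rw [div_pow, Real.sq_sqrt (by positivity)]

lemma psiFn_abs_le (t : ℝ) : |psiFn t| ≤ 1 := by
  rw [← sq_le_one_iff_abs_le_one, psiFn_sq, div_le_one (by positivity)]
  linarith

lemma psiFn_inv (t : ℝ) : psiFn t / √(1 - psiFn t ^ 2) = t := by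
  have h : 1 - psiFn t ^ 2 = 1 / (1 + t ^ 2) := by
    rw [psiFn_sq]; field_simp; ring
  rw [h, Real.sqrt_div zero_le_one, psiFn]
  have : √(1 + t ^ 2) ≠ 0 := by positivity
  rw [Real.sqrt_one]
  field_simp

lemma psiFn_gap (s t : ℝ) : (psiFn s - psiFn t) ^ 2 ≤
    4 * (√(1 + s ^ 2) + √(1 + t ^ 2) - 2 * √(1 + ((1 / 2) * s + (1 / 2) * t) ^ 2)) := by
  unfold psiFn
  have ha2 : √(1 + s ^ 2) ^ 2 = 1 + s ^ 2 := Real.sq_sqrt (by positivity)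
  have hb2 : √(1 + t ^ 2) ^ 2 = 1 + t ^ 2 := Real.sq_sqrt (by positivity)
  have hc2 : √(1 + ((1 / 2) * s + (1 / 2) * t) ^ 2) ^ 2 = 1 + ((1 / 2) * s + (1 / 2) * t) ^ 2 :=
    Real.sq_sqrt (by positivity)
  have ha1 : 1 ≤ √(1 + s ^ 2) := Real.one_le_sqrt.2 (by nlinarith [sq_nonneg s])
  have hb1 : 1 ≤ √(1 + t ^ 2) := Real.one_le_sqrt.2 (by nlinarith [sq_nonneg t])
  have hc0 : 0 ≤ √(1 + ((1 / 2) * s + (1 / 2) * t) ^ 2) := Real.sqrt_nonneg _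
  generalize √(1 + s ^ 2) = a at *
  generalize √(1 + t ^ 2) = b at *
  generalize √(1 + ((1 / 2) * s + (1 / 2) * t) ^ 2) = c at *
  have hK : 0 ≤ a * b - 1 - s * t := by
    have : 1 + s * t ≤ a * b := by
      refine (le_abs_self _).trans (abs_le_of_sq_le_sq ?_ (by positivity))
      rw [mul_pow, ha2, hb2]
      nlinarith [sq_nonneg (s - t)]
    linarith
  have hcle : 2 * c ≤ a + b := by
    refine (le_abs_self _).trans (abs_le_of_sq_le_sq ?_ (by positivity))
    nlinarith
  have h1 : (s / a - t / b) ^ 2 ≤ 2 * (a * b - 1 - s * t) / (a * b) := by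
    have : (s / a - t / b) ^ 2 + (1 / a - 1 / b) ^ 2 = 2 * (a * b - 1 - s * t) / (a * b) := by
      field_simp
      have : s ^ 2 = a ^ 2 - 1 := by linarith
      have : t ^ 2 = b ^ 2 - 1 := by linarith
      nlinarith
    nlinarith [sq_nonneg (1 / a - 1 / b)]
  have h2 : (a * b - 1 - s * t) ≤ (a + b) * (a + b - 2 * c) := by
    have : (a + b - 2 * c) * (a + b + 2 * c) = 2 * (a * b - 1 - s * t) := by nlinarith
    nlinarith
  refine h1.trans ?_
  rw [div_le_iff₀ (by positivity)]
  have h3 : a + b ≤ 2 * (a * b) := by nlinarith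
  nlinarith [mul_le_mul_of_nonneg_right h3 (sub_nonneg.2 hcle)]

section
variable {E : Type*} [NormedAddCommGroup E] [NormedSpace ℝ E]

lemma exists_approx_fixed (C : Set E) (hne : C.Nonempty) (hconv : Convex ℝ C) (R : ℝ)
    (hR : ∀ z ∈ C, ‖z‖ ≤ R) (T : E → E) (hmaps : Set.MapsTo T C C)
    (haff : ∀ x ∈ C, ∀ y ∈ C, ∀ l : ℝ, 0 ≤ l → l ≤ 1 →
      T (l • x + (1 - l) • y) = l • T x + (1 - l) • T y) (ε : ℝ) (hε : 0 < ε) :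
    ∃ z ∈ C, ‖T z - z‖ ≤ ε := by
  obtain ⟨y, hy⟩ := hne
  have hit : ∀ n, T^[n] y ∈ C := fun n => hmaps.iterate n hy
  have key : ∀ n : ℕ, ∃ z ∈ C, ((n : ℝ) + 1) • (T z - z) = T^[n + 1] y - y := by
    intro n
    induction n with
    | zero => exact ⟨y, hy, by simp⟩
    | succ n ih =>
      obtain ⟨z, hz, hz'⟩ := ih
      have hn : (0 : ℝ) < n + 2 := by positivity
      have h0 : (0 : ℝ) ≤ 1 / (n + 2) := by positivity
      have h1 : 1 / ((n : ℝ) + 2) ≤ 1 := by rw [div_le_one hn]; linarith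
      refine ⟨(1 / ((n : ℝ) + 2)) • T^[n + 1] y + (1 - 1 / ((n : ℝ) + 2)) • z,
        hconv (hit _) hz h0 (by linarith) (by ring), ?_⟩
      rw [haff _ (hit _) _ hz _ h0 h1, ← Function.iterate_succ_apply' T]
      have e : T^[n + 1 + 1] y - y =
        (T^[n + 1 + 1] y - T^[n + 1] y) + ((n : ℝ) + 1) • (T z - z) := by rw [hz']; abel
      rw [e]
      push_cast
      match_scalars <;> field_simp <;> ring
  obtain ⟨n, hn⟩ := exists_nat_gt (2 * R / ε)
  obtain ⟨z, hz, hz'⟩ := key n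
  refine ⟨z, hz, ?_⟩
  have h1 : ‖((n : ℝ) + 1) • (T z - z)‖ ≤ 2 * R := by
    rw [hz']
    refine (norm_sub_le _ _).trans ?_
    linarith [hR _ (hit (n + 1)), hR _ hy]
  rw [norm_smul, Real.norm_of_nonneg (by positivity)] at h1
  rw [div_lt_iff₀ hε] at hn
  have hp : (0 : ℝ) < n + 1 := by positivity
  by_contra hcon
  push Not at hcon
  nlinarith
end

section
variable {Ω : Type*} [MeasurableSpace Ω] {μ : Measure Ω} [IsFiniteMeasure μ]

/-- `L¹` Brezis-Lieb -/
lemma brezis_lieb (z : ℕ → Lp ℝ 1 μ) (x y : Lp ℝ 1 μ) 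
    (h : ∀ᵐ ω ∂μ, Tendsto (fun n => (z n : Ω → ℝ) ω) atTop (𝓝 ((x : Ω → ℝ) ω))) :
    Tendsto (fun n => ‖y - z n‖ - ‖x - z n‖) atTop (𝓝 ‖x - y‖) := by
  have hnorm : ∀ u v : Lp ℝ 1 μ, ‖u - v‖ = ∫ ω, |(u : Ω → ℝ) ω - (v : Ω → ℝ) ω| ∂μ := by
    intro u v
    rw [L1.norm_eq_integral_norm]
    apply integral_congr_ae
    filter_upwards [Lp.coeFn_sub u v] with ω hω
    rw [hω, Pi.sub_apply, Real.norm_eq_abs]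
  have hint : ∀ u v : Lp ℝ 1 μ, Integrable (fun ω => |(u : Ω → ℝ) ω - (v : Ω → ℝ) ω|) μ :=
    fun u v => ((L1.integrable_coeFn u).sub (L1.integrable_coeFn v)).abs
  have e : (fun n => ‖y - z n‖ - ‖x - z n‖) = fun n => ∫ ω, (|(y : Ω → ℝ) ω - (z n : Ω → ℝ) ω|
      - |(x : Ω → ℝ) ω - (z n : Ω → ℝ) ω|) ∂μ := by
    funext n
    rw [integral_sub (hint _ _) (hint _ _), hnorm, hnorm]
  rw [e, hnorm]
  refine tendsto_integral_of_dominated_convergence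
    (fun ω => |(x : Ω → ℝ) ω - (y : Ω → ℝ) ω|) ?_ (hint _ _) ?_ ?_
  · intro n
    exact ((hint _ _).sub (hint _ _)).aestronglyMeasurable
  · intro n
    refine ae_of_all _ fun ω => ?_
    rw [Real.norm_eq_abs, abs_sub_comm ((x : Ω → ℝ) ω) ((y : Ω → ℝ) ω)]
    refine (abs_abs_sub_abs_le_abs_sub _ _).trans (le_of_eq ?_)
    congr 1; ring
  · filter_upwards [h] with ω hω
    have h1 := ((tendsto_const_nhds (x := (y : Ω → ℝ) ω)).sub hω).abs
    have h2 := ((tendsto_const_nhds (x := (x : Ω → ℝ) ω)).sub hω).abs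
    have := h1.sub h2
    rwa [sub_self, abs_zero, sub_zero, abs_sub_comm] at this

noncomputable def Jfun (z : Lp ℝ 1 μ) : ℝ := ∫ ω, √(1 + (z : Ω → ℝ) ω ^ 2) ∂μ

lemma Jfun_bound (t : ℝ) : √(1 + t ^ 2) ≤ 1 + |t| := by
  rw [Real.sqrt_le_left (by positivity)]
  nlinarith [abs_nonneg t, sq_abs t]

lemma Jfun_integrable (z : Lp ℝ 1 μ) : Integrable (fun ω => √(1 + (z : Ω → ℝ) ω ^ 2)) μ := by
  refine Integrable.mono' ((integrable_const (1 : ℝ)).add (L1.integrable_coeFn z).abs) ?_ ?_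
  · have : Continuous fun t : ℝ => √(1 + t ^ 2) := by fun_prop
    exact this.comp_aestronglyMeasurable (Lp.aestronglyMeasurable z)
  · refine ae_of_all _ fun ω => ?_
    rw [Real.norm_of_nonneg (Real.sqrt_nonneg _)]
    exact Jfun_bound _

lemma Jfun_nonneg (z : Lp ℝ 1 μ) : 0 ≤ Jfun z := integral_nonneg fun ω => Real.sqrt_nonneg _

lemma Jfun_le (z : Lp ℝ 1 μ) : Jfun z ≤ μ.real Set.univ + ‖z‖ := by
  have : Jfun z ≤ ∫ ω, (1 + |(z : Ω → ℝ) ω|) ∂μ :=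
    integral_mono (Jfun_integrable z)
      ((integrable_const (1 : ℝ)).add (L1.integrable_coeFn z).abs) (fun ω => Jfun_bound _)
  rw [integral_add (integrable_const _) (L1.integrable_coeFn z).abs] at this
  rw [L1.norm_eq_integral_norm]
  simpa using this

lemma psi_memLp (z : Lp ℝ 1 μ) : MemLp (fun ω => psiFn ((z : Ω → ℝ) ω)) 2 μ :=
  MemLp.of_bound (psiFn_cont.comp_aestronglyMeasurable (Lp.aestronglyMeasurable z)) 1
    (ae_of_all _ fun ω => psiFn_abs_le _)

noncomputable def psiLp (z : Lp ℝ 1 μ) : Lp ℝ 2 μ := (psi_memLp z).toLp _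

lemma psiLp_gap (z w : Lp ℝ 1 μ) : ‖psiLp z - psiLp w‖ ^ 2 ≤
    4 * (Jfun z + Jfun w - 2 * Jfun ((1 / 2 : ℝ) • z + (1 / 2 : ℝ) • w)) := by
  have e1 : ‖psiLp z - psiLp w‖ ^ 2 =
      ∫ ω, (psiFn ((z : Ω → ℝ) ω) - psiFn ((w : Ω → ℝ) ω)) ^ 2 ∂μ := by
    rw [← real_inner_self_eq_norm_sq, L2.inner_def]
    apply integral_congr_ae
    filter_upwards [Lp.coeFn_sub (psiLp z) (psiLp w), (psi_memLp z).coeFn_toLp,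
      (psi_memLp w).coeFn_toLp] with ω h1 h2 h3
    rw [real_inner_self_eq_norm_sq, h1, Pi.sub_apply, psiLp, psiLp, h2, h3, Real.norm_eq_abs,
      sq_abs]
  have hi : Integrable (fun ω => √(1 + (z : Ω → ℝ) ω ^ 2) + √(1 + (w : Ω → ℝ) ω ^ 2)) μ :=
    (Jfun_integrable z).add (Jfun_integrable w)
  rw [e1, Jfun, Jfun, Jfun, ← integral_const_mul, ← integral_add (Jfun_integrable z)
    (Jfun_integrable w), ← integral_sub hi ((Jfun_integrable _).const_mul _),
    ← integral_const_mul]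
  refine integral_mono_ae ((psi_memLp z).sub (psi_memLp w)).integrable_sq
    ((((Jfun_integrable z).add (Jfun_integrable w)).sub
    ((Jfun_integrable _).const_mul _)).const_mul _) ?_
  filter_upwards [Lp.coeFn_add ((1 / 2 : ℝ) • z) ((1 / 2 : ℝ) • w), Lp.coeFn_smul (1 / 2 : ℝ) z,
    Lp.coeFn_smul (1 / 2 : ℝ) w] with ω h1 h2 h3
  simp only [h1, Pi.add_apply, h2, h3, Pi.smul_apply, smul_eq_mul]
  exact psiFn_gap _ _

lemma exists_cauchy (D : ℕ → Set (Lp ℝ 1 μ)) (hanti : Antitone D) (hne : ∀ n, (D n).Nonempty)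
    (hconv : ∀ n, Convex ℝ (D n)) (R : ℝ) (hR : ∀ n, ∀ z ∈ D n, ‖z‖ ≤ R) :
    ∃ z : ℕ → Lp ℝ 1 μ, (∀ n, z n ∈ D n) ∧ CauchySeq (fun n => psiLp (z n)) := by
  set a : ℕ → ℝ := fun n => sInf (Jfun '' D n) with ha
  have hbb : ∀ n, BddBelow (Jfun '' D n) := fun n =>
    ⟨0, by rintro _ ⟨z, -, rfl⟩; exact Jfun_nonneg z⟩
  have hale : ∀ n, ∀ z ∈ D n, a n ≤ Jfun z := fun n z hz => csInf_le (hbb n) ⟨z, hz, rfl⟩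
  have hmono : Monotone a := fun n m hnm =>
    csInf_le_csInf (hbb n) ((hne m).image _) (Set.image_mono (hanti hnm))
  have hbdd : BddAbove (Set.range a) := by
    refine ⟨μ.real Set.univ + R, ?_⟩
    rintro _ ⟨n, rfl⟩
    obtain ⟨z, hz⟩ := hne n
    linarith [hale n z hz, Jfun_le z, hR n z hz]
  have hlim := tendsto_atTop_ciSup hmono hbdd
  set A := ⨆ n, a n
  have hex : ∀ n : ℕ, ∃ z ∈ D n, Jfun z < a n + 1 / ((n : ℝ) + 1) := by
    intro n
    obtain ⟨_, ⟨z, hz, rfl⟩, h⟩ := exists_lt_of_csInf_lt ((hne n).image Jfun)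
      (show sInf (Jfun '' D n) < a n + 1 / ((n : ℝ) + 1) from
        lt_add_of_pos_right _ (by positivity))
    exact ⟨z, hz, h⟩
  choose z hz hJ using hex
  refine ⟨z, hz, ?_⟩
  rw [Metric.cauchySeq_iff']
  intro ε hε
  have hb : Tendsto (fun n : ℕ => 4 * ((A - a n) + 2 * (1 / ((n : ℝ) + 1)))) atTop (𝓝 0) := by
    have := ((tendsto_const_nhds (x := A)).sub hlim).add
      ((tendsto_one_div_add_atTop_nhds_zero_nat (𝕜 := ℝ)).const_mul 2)
    simpa using this.const_mul 4
  obtain ⟨N, hN⟩ := (hb.eventually (gt_mem_nhds (show (0 : ℝ) < ε ^ 2 by positivity))).exists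
  refine ⟨N, fun n hn => ?_⟩
  rw [dist_eq_norm]
  have hmid : (1 / 2 : ℝ) • z n + (1 / 2 : ℝ) • z N ∈ D N :=
    hconv N (hanti hn (hz n)) (hz N) (by norm_num) (by norm_num) (by norm_num)
  have h1 := psiLp_gap (z n) (z N)
  have h2 := hale N _ hmid
  have h3 : a n ≤ A := le_ciSup hbdd n
  have h4 : 1 / ((n : ℝ) + 1) ≤ 1 / ((N : ℝ) + 1) := by
    apply one_div_le_one_div_of_le (by positivity)
    have : (N : ℝ) ≤ n := by exact_mod_cast hn
    linarith
  refine lt_of_pow_lt_pow_left₀ 2 hε.le ?_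
  linarith [hJ n, hJ N]

lemma exists_ae_conv (D : ℕ → Set (Lp ℝ 1 μ)) (hanti : Antitone D) (hne : ∀ n, (D n).Nonempty)
    (hconv : ∀ n, Convex ℝ (D n)) (R : ℝ) (hR : ∀ n, ∀ z ∈ D n, ‖z‖ ≤ R) :
    ∃ (z : ℕ → Lp ℝ 1 μ) (x : Lp ℝ 1 μ), (∀ n, z n ∈ D n) ∧
      ∀ᵐ ω ∂μ, Tendsto (fun n => (z n : Ω → ℝ) ω) atTop (𝓝 ((x : Ω → ℝ) ω)) := by
  obtain ⟨w, hw, hc⟩ := exists_cauchy D hanti hne hconv R hR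
  obtain ⟨g, hg⟩ := cauchySeq_tendsto_of_complete hc
  obtain ⟨ns, hns, hae⟩ := (tendstoInMeasure_of_tendsto_Lp hg).exists_seq_tendsto_ae
  have hzD : ∀ n, w (ns n) ∈ D n := fun n => hanti hns.le_apply (hw _)
  set z := fun n => w (ns n) with hz
  have hnb : ∀ n, eLpNorm (z n : Ω → ℝ) 1 μ ≤ (R.toNNReal : ENNReal) := by
    intro n
    have := hR n _ (hzD n)
    rw [Lp.norm_def] at this
    exact ENNReal.le_ofReal_iff_toReal_le (Lp.eLpNorm_ne_top _) 
      ((ENNReal.toReal_nonneg).trans this) |>.2 this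
  have hlimf := ae_bdd_liminf_atTop_of_eLpNorm_bdd (μ := μ) one_ne_zero
    (fun n => (Lp.stronglyMeasurable (z n)).measurable) hnb
  have hpsi : ∀ᵐ ω ∂μ, ∀ n, (psiLp (z n) : Ω → ℝ) ω = psiFn ((z n : Ω → ℝ) ω) :=
    ae_all_iff.2 fun n => (psi_memLp (z n)).coeFn_toLp
  set x0 : Ω → ℝ := fun ω => (g : Ω → ℝ) ω / √(1 - (g : Ω → ℝ) ω ^ 2) with hx0
  have hconvx : ∀ᵐ ω ∂μ, Tendsto (fun n => (z n : Ω → ℝ) ω) atTop (𝓝 (x0 ω)) := by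
    filter_upwards [hlimf, hpsi, hae] with ω h1 h2 h3
    have h3' : Tendsto (fun n => psiFn ((z n : Ω → ℝ) ω)) atTop (𝓝 ((g : Ω → ℝ) ω)) :=
      h3.congr h2
    obtain ⟨K, hK1, hK2⟩ := ENNReal.lt_iff_exists_nnreal_btwn.1 h1
    have hfr := frequently_lt_of_liminf_lt (by isBoundedDefault) hK1
    have hlt : (g : Ω → ℝ) ω ^ 2 ≤ (K : ℝ) ^ 2 / (1 + (K : ℝ) ^ 2) := by
      refine le_of_tendsto_of_frequently (h3'.pow 2) (hfr.mono fun n hn => ?_)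
      have hn' : |(z n : Ω → ℝ) ω| < K := by
        have : ‖(z n : Ω → ℝ) ω‖₊ < K := by exact_mod_cast hn
        exact_mod_cast this
      have hn2 : (z n : Ω → ℝ) ω ^ 2 ≤ (K : ℝ) ^ 2 := by
        rw [← sq_abs]; gcongr
      rw [psiFn_sq, div_le_div_iff₀ (by positivity) (by positivity)]
      nlinarith
    have hlt1 : (g : Ω → ℝ) ω ^ 2 < 1 := by
      refine hlt.trans_lt ?_
      rw [div_lt_one (by positivity)]; linarith
    have hpos : 0 < √(1 - (g : Ω → ℝ) ω ^ 2) := Real.sqrt_pos.2 (by linarith)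
    have := h3'.div ((tendsto_const_nhds (x := (1 : ℝ))).sub (h3'.pow 2)).sqrt hpos.ne'
    refine this.congr fun n => ?_
    exact psiFn_inv _
  have hmem : MemLp x0 1 μ := by
    refine ⟨aestronglyMeasurable_of_tendsto_ae atTop (fun n => Lp.aestronglyMeasurable (z n))
      hconvx, ?_⟩
    exact (Lp.eLpNorm_le_of_ae_tendsto (Eventually.of_forall hnb)
      (fun n => Lp.aestronglyMeasurable (z n)) hconvx).trans_lt ENNReal.coe_lt_top
  refine ⟨z, hmem.toLp x0, hzD, ?_⟩
  filter_upwards [hconvx, hmem.coeFn_toLp] with ω h1 h2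
  rwa [h2]

/-- `z` is an approximate fixed point sequence in `C`, a.e. convergent to `x`, with
asymptotic distance `r`. -/
def GoodSeq (C : Set (Lp ℝ 1 μ)) (T : Lp ℝ 1 μ → Lp ℝ 1 μ) (x : Lp ℝ 1 μ) (r : ℝ)
    (z : ℕ → Lp ℝ 1 μ) : Prop :=
  (∀ n, z n ∈ C) ∧ Tendsto (fun n => ‖T (z n) - z n‖) atTop (𝓝 0) ∧
  (∀ᵐ ω ∂μ, Tendsto (fun n => (z n : Ω → ℝ) ω) atTop (𝓝 ((x : Ω → ℝ) ω))) ∧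
  Tendsto (fun n => ‖x - z n‖) atTop (𝓝 r)

lemma GoodSeq.lim {C : Set (Lp ℝ 1 μ)} {T : Lp ℝ 1 μ → Lp ℝ 1 μ} {x : Lp ℝ 1 μ} {r : ℝ}
    {z : ℕ → Lp ℝ 1 μ} (h : GoodSeq C T x r z) (y : Lp ℝ 1 μ) :
    Tendsto (fun n => ‖y - z n‖) atTop (𝓝 (‖x - y‖ + r)) := by
  have := (brezis_lieb z x y h.2.2.1).add h.2.2.2
  simpa using this

lemma exists_goodSeq (C : Set (Lp ℝ 1 μ)) (hne : C.Nonempty) (hconv : Convex ℝ C) (R : ℝ)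
    (hR : ∀ z ∈ C, ‖z‖ ≤ R) (T : Lp ℝ 1 μ → Lp ℝ 1 μ) (hmaps : Set.MapsTo T C C)
    (haff : ∀ x ∈ C, ∀ y ∈ C, ∀ l : ℝ, 0 ≤ l → l ≤ 1 →
      T (l • x + (1 - l) • y) = l • T x + (1 - l) • T y) :
    ∃ x r z, GoodSeq C T x r z := by
  have hA : Antitone (fun n : ℕ => {z | z ∈ C ∧ ‖T z - z‖ ≤ 1 / ((n : ℝ) + 1)}) := by
    rintro n m hnm z ⟨hz, hz'⟩
    refine ⟨hz, hz'.trans ?_⟩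
    apply one_div_le_one_div_of_le (by positivity)
    have : (n : ℝ) ≤ m := by exact_mod_cast hnm
    linarith
  have hN : ∀ n : ℕ, ((fun n : ℕ => {z | z ∈ C ∧ ‖T z - z‖ ≤ 1 / ((n : ℝ) + 1)}) n).Nonempty := by
    intro n
    obtain ⟨z, hz, h⟩ := exists_approx_fixed C hne hconv R hR T hmaps haff (1 / ((n : ℝ) + 1))
      (by positivity)
    exact ⟨z, hz, h⟩
  have hV : ∀ n : ℕ, Convex ℝ ((fun n : ℕ => {z | z ∈ C ∧ ‖T z - z‖ ≤ 1 / ((n : ℝ) + 1)}) n) := by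
    rintro n u ⟨hu, hu'⟩ v ⟨hv, hv'⟩ a b ha hb hab
    refine ⟨hconv hu hv ha hb hab, ?_⟩
    obtain rfl : b = 1 - a := by linarith
    rw [haff u hu v hv a ha (by linarith)]
    have e : a • T u + (1 - a) • T v - (a • u + (1 - a) • v) =
      a • (T u - u) + (1 - a) • (T v - v) := by module
    rw [e]
    refine (norm_add_le _ _).trans ?_
    rw [norm_smul, norm_smul, Real.norm_of_nonneg ha, Real.norm_of_nonneg hb]
    nlinarith
  obtain ⟨z, x, hz, hae⟩ := exists_ae_conv
    (fun n : ℕ => {z | z ∈ C ∧ ‖T z - z‖ ≤ 1 / ((n : ℝ) + 1)}) hA hN hV R (fun n z hz => hR z hz.1)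
  have hb : ∀ n, ‖x - z n‖ ∈ Set.Icc 0 (‖x‖ + R) := fun n =>
    ⟨norm_nonneg _, (norm_sub_le _ _).trans (by linarith [hR _ (hz n).1])⟩
  obtain ⟨r, -, φ, hφ, hr⟩ := isCompact_Icc.tendsto_subseq hb
  refine ⟨x, r, z ∘ φ, fun n => (hz _).1, ?_, ?_, hr⟩
  · have : Tendsto (fun n => ‖T (z n) - z n‖) atTop (𝓝 0) :=
      squeeze_zero (fun n => norm_nonneg _) (fun n => (hz n).2)
        tendsto_one_div_add_atTop_nhds_zero_nat
    exact this.comp hφ.tendsto_atTop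
  · filter_upwards [hae] with ω h
    exact h.comp hφ.tendsto_atTop
end

theorem fixedPoint_affine_nonexpansive_of_tCoef_lt_two
    {Ω : Type*} [MeasurableSpace Ω] (μ : Measure Ω) [IsFiniteMeasure μ]
    (C : Set (Lp ℝ 1 μ)) (hne : C.Nonempty) (hclosed : IsClosed C)
    (hconv : Convex ℝ C) (hbdd : Bornology.IsBounded C)
    (lam : ℝ) (hlam : lam < 2)
    (hcoef : ∀ (xs : ℕ → Lp ℝ 1 μ) (x : Lp ℝ 1 μ), (∀ n, xs n ∈ C) →
      (∀ᵐ ω ∂μ, Tendsto (fun n => (xs n : Ω → ℝ) ω) atTop (𝓝 ((x : Ω → ℝ) ω))) →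
      sInf ((fun c => limsup (fun n => ‖c - xs n‖) atTop) '' C) ≤
        lam * limsup (fun n => ‖x - xs n‖) atTop)
    (T : Lp ℝ 1 μ → Lp ℝ 1 μ) (hmaps : Set.MapsTo T C C)
    (haff : ∀ x ∈ C, ∀ y ∈ C, ∀ l : ℝ, 0 ≤ l → l ≤ 1 →
      T (l • x + (1 - l) • y) = l • T x + (1 - l) • T y)
    (hnonexp : ∀ f ∈ C, ∀ g ∈ C, ‖T f - T g‖ ≤ ‖f - g‖) :
    ∃ x ∈ C, T x = x := by
  obtain ⟨R, hR⟩ := hbdd.exists_norm_le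
  obtain ⟨θ, hθ0, hθ1, hθl⟩ : ∃ θ : ℝ, 0 ≤ θ ∧ θ < 1 ∧ lam < 1 + θ := by
    refine ⟨max 0 (lam / 2), le_max_left _ _, max_lt one_pos (by linarith), ?_⟩
    linarith [le_max_right 0 (lam / 2)]
  have step : ∀ x r z, GoodSeq C T x r z →
      ∃ x' r' z', GoodSeq C T x' r' z' ∧ r' ≤ θ * r ∧ ‖x - x'‖ ≤ θ * r := by
    intro x r z h
    have hr0 : 0 ≤ r := ge_of_tendsto' h.2.2.2 fun n => norm_nonneg _
    rcases hr0.eq_or_lt with rfl | hr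
    · exact ⟨x, 0, z, h, by simp, by simp⟩
    have hc := hcoef z x h.1 h.2.2.1
    rw [h.2.2.2.limsup_eq] at hc
    obtain ⟨_, ⟨c, hcC, rfl⟩, hc'⟩ := exists_lt_of_csInf_lt (hne.image _)
      (hc.trans_lt (mul_lt_mul_of_pos_right hθl hr))
    simp only [(h.lim c).limsup_eq] at hc'
    obtain ⟨x', r', z', h'⟩ := exists_goodSeq (C ∩ {y | ‖x - y‖ ≤ θ * r}) 
      ⟨c, hcC, by simp only [Set.mem_ofPred_eq]; linarith⟩ 
      (hconv.inter (by
        have := convex_closedBall x (θ * r)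
        convert this using 1
        ext y
        simp [dist_eq_norm, norm_sub_rev])) R (fun z hz => hR z hz.1) T 
      (by
        rintro y ⟨hy, hy'⟩
        refine ⟨hmaps hy, ?_⟩
        have h1 : ‖x - T y‖ + r ≤ ‖x - y‖ + r + 0 := by
          refine le_of_tendsto_of_tendsto' (h.lim (T y)) ((h.lim y).add h.2.1) fun n => ?_
          calc ‖T y - z n‖ = ‖(T y - T (z n)) + (T (z n) - z n)‖ := by congr 1; abel
            _ ≤ _ := (norm_add_le _ _).trans (by gcongr; exact hnonexp _ hy _ (h.1 n))
        simp only [Set.mem_ofPred_eq] at hy' ⊢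
        linarith)
      (fun x hx y hy => haff x hx.1 y hy.1)
    have h1 : ‖x' - x‖ + r' ≤ θ * r := le_of_tendsto' (h'.lim x) fun n => (h'.1 n).2
    have hr' : 0 ≤ r' := ge_of_tendsto' h'.2.2.2 fun n => norm_nonneg _
    refine ⟨x', r', z', ⟨fun n => (h'.1 n).1, h'.2⟩, ?_, ?_⟩
    · linarith [norm_nonneg (x' - x)]
    · rw [norm_sub_rev]; linarith
  obtain ⟨x0, r0, z0, h0⟩ := exists_goodSeq C hne hconv R hR T hmaps haff
  let S := {p : Lp ℝ 1 μ × ℝ // ∃ z, GoodSeq C T p.1 p.2 z}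
  have hS : ∀ p : S, ∃ q : S, q.1.2 ≤ θ * p.1.2 ∧ ‖p.1.1 - q.1.1‖ ≤ θ * p.1.2 := by
    rintro ⟨⟨x, r⟩, z, h⟩
    obtain ⟨x', r', z', h', h1, h2⟩ := step x r z h
    exact ⟨⟨(x', r'), z', h'⟩, h1, h2⟩
  choose F hF1 hF2 using hS
  let p : ℕ → S := fun n => F^[n] ⟨(x0, r0), z0, h0⟩
  have hp : ∀ n, p (n + 1) = F (p n) := fun n => Function.iterate_succ_apply' F n _
  have hrn : ∀ n, (p n).1.2 ≤ r0 * θ ^ n := by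
    intro n
    induction n with
    | zero => simp [p]
    | succ n ih =>
      rw [hp]
      calc _ ≤ θ * (p n).1.2 := hF1 _
        _ ≤ θ * (r0 * θ ^ n) := by gcongr
        _ = _ := by ring
  have hd : ∀ n, dist (p n).1.1 (p (n + 1)).1.1 ≤ (θ * r0) * θ ^ n := by
    intro n
    rw [hp, dist_eq_norm]
    calc _ ≤ θ * (p n).1.2 := hF2 _
        _ ≤ θ * (r0 * θ ^ n) := by gcongr; exact hrn n
        _ = _ := by ring
  obtain ⟨y, hy⟩ := cauchySeq_tendsto_of_complete (cauchySeq_of_le_geometric θ _ hθ1 hd)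
  have key : ∀ ε > 0, ∃ w ∈ C, ‖w - y‖ < ε ∧ ‖T w - w‖ < ε := by
    intro ε hε
    have hr : Tendsto (fun n => r0 * θ ^ n) atTop (𝓝 0) := by
      simpa using (tendsto_pow_atTop_nhds_zero_of_lt_one hθ0 hθ1).const_mul r0
    obtain ⟨k, hk1, hk2⟩ := ((hr.eventually (gt_mem_nhds (half_pos hε))).and
      (Metric.tendsto_nhds.1 hy _ (half_pos hε))).exists
    obtain ⟨z, hz⟩ := (p k).2
    obtain ⟨n, hn1, hn2⟩ := ((hz.2.2.2.eventually (gt_mem_nhds ((hrn k).trans_lt hk1))).and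
      (hz.2.1.eventually (gt_mem_nhds hε))).exists
    refine ⟨z n, hz.1 n, ?_, hn2⟩
    rw [dist_eq_norm] at hk2
    calc ‖z n - y‖ = ‖((p k).1.1 - y) - ((p k).1.1 - z n)‖ := by congr 1; abel
      _ ≤ _ := norm_sub_le _ _
      _ < ε := by linarith
  have hyC : y ∈ C := by
    rw [← hclosed.closure_eq, Metric.mem_closure_iff]
    intro ε hε
    obtain ⟨w, hw, h1, -⟩ := key ε hε
    exact ⟨w, hw, by rwa [dist_comm, dist_eq_norm]⟩
  refine ⟨y, hyC, ?_⟩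
  rw [← sub_eq_zero, ← norm_le_zero_iff]
  refine le_of_forall_pos_le_add fun ε hε => ?_
  obtain ⟨w, hw, h1, h2⟩ := key (ε / 3) (by positivity)
  have h3 := hnonexp y hyC w hw
  rw [norm_sub_rev y w] at h3
  calc ‖T y - y‖ = ‖(T y - T w) + (T w - w) + (w - y)‖ := by congr 1; abel
    _ ≤ _ := norm_add₃_le
    _ ≤ 0 + ε := by linarith
end
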